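/- arXiv:1908.10034 — 2 statements merged into one kernel-verified Lean document; each statement's English description precedes it below -/
import Mathlib

section
/- Let A be a right distributive, right Noetherian, centrally essential, indecomposable ring which is not semiprime (i.e., there exists a nonzero a ∈ A with a·x·a = 0 for all x ∈ A, equivalently, the prime radical of A is nonzero). Then A is a uniserial (left and right) Artinian ring. -/
/-- A ring `A` is *centrally essential* if for every nonzero `a ∈ A` there exist
nonzero central elements `c, d ∈ A` with `a * c = d`. -/
def IsCentrallyEssential (A : Type*) [Ring A] : Prop :=
  ∀ a : A, a ≠ 0 → ∃ c d : A, c ∈ Set.center A ∧ d ∈ Set.center A ∧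
    c ≠ 0 ∧ d ≠ 0 ∧ a * c = d

/-- A ring is *right distributive* if the lattice of its right ideals is distributive. -/
def IsRightDistributive (A : Type*) [Ring A] : Prop :=
  ∀ I J K : Submodule Aᵐᵒᵖ A, I ⊓ (J ⊔ K) = (I ⊓ J) ⊔ (I ⊓ K)

/-- A ring is *uniserial* if its right ideals are totally ordered by inclusion and its
left ideals are totally ordered by inclusion. -/
def IsUniserialRing (A : Type*) [Ring A] : Prop :=
  (∀ I J : Submodule Aᵐᵒᵖ A, I ≤ J ∨ J ≤ I) ∧ (∀ I J : Ideal A, I ≤ J ∨ J ≤ I)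

/-- A ring is *Artinian* if it is both left and right Artinian. -/
def IsArtinianBothSides (A : Type*) [Ring A] : Prop :=
  IsArtinian A A ∧ IsArtinian Aᵐᵒᵖ A

section AnnihilatorPrime
variable {A : Type*} [Ring A]

theorem IsCentrallyEssential.exists_central (h : IsCentrallyEssential A) {a : A} (ha : a ≠ 0) :
    ∃ c : A, (∀ x, c * x = x * c) ∧ (∀ x, a * c * x = x * (a * c)) ∧ a * c ≠ 0 := by
  obtain ⟨c, d, hc, hd, -, hd0, rfl⟩ := h a ha
  exact ⟨c, fun x => (Semigroup.mem_center_iff.1 hc x).symm,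
    fun x => (Semigroup.mem_center_iff.1 hd x).symm, hd0⟩

theorem mem_span_op_singleton {a x : A} :
    x ∈ Submodule.span Aᵐᵒᵖ ({a} : Set A) ↔ ∃ r, x = a * r := by
  rw [Submodule.mem_span_singleton]
  constructor
  · rintro ⟨r, rfl⟩
    exact ⟨r.unop, rfl⟩
  · rintro ⟨r, rfl⟩
    exact ⟨MulOpposite.op r, rfl⟩

/-- Among the elements satisfying `p`, there is one whose principal right ideal is maximal. -/
theorem exists_maximal_span (hn : IsNoetherian Aᵐᵒᵖ A) {p : A → Prop} (hp : ∃ x, p x) :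
    ∃ x, p x ∧ ∀ y, p y → (∃ r, x = y * r) → ∃ r, y = x * r := by
  obtain ⟨x₀, hx₀⟩ := hp
  obtain ⟨_, ⟨x, hx, rfl⟩, hmax⟩ := set_has_maximal_iff_noetherian.2 hn
    ((fun x : A => Submodule.span Aᵐᵒᵖ ({x} : Set A)) '' {x | p x}) ⟨_, x₀, hx₀, rfl⟩
  refine ⟨x, hx, fun y hy hxy => mem_span_op_singleton.1 ?_⟩
  have hle : Submodule.span Aᵐᵒᵖ ({x} : Set A) ≤ Submodule.span Aᵐᵒᵖ {y} := by
    rw [Submodule.span_singleton_le_iff_mem]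
    exact mem_span_op_singleton.2 hxy
  by_contra hc
  refine hmax _ ⟨y, hy, rfl⟩ (lt_of_le_not_ge hle fun h => hc ?_)
  exact h (Submodule.mem_span_singleton_self y)

/-- The right annihilator of an element. -/
def rightAnnihilator (a : A) : Submodule Aᵐᵒᵖ A where
  carrier := {r | a * r = 0}
  add_mem' {x y} hx hy := by
    simp only [Set.mem_ofPred_eq] at *
    rw [mul_add, hx, hy, add_zero]
  zero_mem' := mul_zero a
  smul_mem' c x hx := by
    simp only [Set.mem_ofPred_eq] at *
    rw [MulOpposite.smul_eq_mul_unop, ← mul_assoc, hx, zero_mul]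

theorem mem_rightAnnihilator {a r : A} : r ∈ rightAnnihilator a ↔ a * r = 0 := Iff.rfl

/-- Among the elements satisfying `p`, there is one whose right annihilator is maximal. -/
theorem exists_maximal_rightAnnihilator (hn : IsNoetherian Aᵐᵒᵖ A) {p : A → Prop}
    (hp : ∃ x, p x) :
    ∃ x, p x ∧ ∀ y, p y → (∀ r, x * r = 0 → y * r = 0) → ∀ r, y * r = 0 → x * r = 0 := by
  obtain ⟨x₀, hx₀⟩ := hp
  obtain ⟨_, ⟨x, hx, rfl⟩, hmax⟩ := set_has_maximal_iff_noetherian.2 hn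
    (rightAnnihilator '' {x : A | p x}) ⟨_, x₀, hx₀, rfl⟩
  refine ⟨x, hx, fun y hy hxy => ?_⟩
  by_contra hc
  exact hmax _ ⟨y, hy, rfl⟩ (lt_of_le_not_ge hxy hc)

theorem exists_pow_rightAnnihilator_stable (hn : IsNoetherian Aᵐᵒᵖ A) (x : A) :
    ∃ n : ℕ, ∀ b, x ^ (n + 1) * b = 0 → x ^ n * b = 0 := by
  obtain ⟨n, h⟩ := monotone_stabilizes_iff_noetherian.2 hn
    ⟨fun n => rightAnnihilator (x ^ n), monotone_nat_of_le_succ fun n r hr => by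
      rw [mem_rightAnnihilator] at *
      rw [pow_succ', mul_assoc, hr, mul_zero]⟩
  refine ⟨n, fun b hb => ?_⟩
  have := h (n + 1) (Nat.le_succ n)
  simp only [OrderHom.coe_mk] at this
  exact (this ▸ mem_rightAnnihilator.2 hb : b ∈ rightAnnihilator (x ^ n))

theorem IsRightDistributive.exists_add_eq_one (h : IsRightDistributive A) (a b : A) :
    ∃ x y r s : A, x + y = 1 ∧ a * x = b * r ∧ b * y = a * s := by
  have hmem : a + b ∈ Submodule.span Aᵐᵒᵖ ({a + b} : Set A) ⊓
      (Submodule.span Aᵐᵒᵖ {a} ⊔ Submodule.span Aᵐᵒᵖ {b}) :=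
    ⟨Submodule.mem_span_singleton_self _,
      Submodule.add_mem_sup (Submodule.mem_span_singleton_self _)
        (Submodule.mem_span_singleton_self _)⟩
  rw [h, Submodule.mem_sup] at hmem
  obtain ⟨u, ⟨hu, hua⟩, v, ⟨hv, hvb⟩, huv⟩ := hmem
  obtain ⟨r, rfl⟩ := mem_span_op_singleton.1 hu
  obtain ⟨r', hr'⟩ := mem_span_op_singleton.1 hua
  obtain ⟨s, rfl⟩ := mem_span_op_singleton.1 hv
  obtain ⟨s', hs'⟩ := mem_span_op_singleton.1 hvb
  refine ⟨1 - r, r, s' - s - (1 - r - s), r' - r, by abel, ?_, ?_⟩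
  · simp only [mul_sub, add_mul, mul_one] at *
    grind
  · simp only [mul_sub, add_mul] at *
    grind

theorem IsRightDistributive.one_sub_mul_mul_idempotent (h : IsRightDistributive A) {f : A}
    (hf : f * f = f) (y : A) : (1 - f) * y * f = 0 := by
  obtain ⟨u, v, r, s, huv, hu, hv⟩ := h.exists_add_eq_one (f + (1 - f) * y * f) f
  set z := (1 - f) * y * f with hz
  have hgf : (1 - f) * f = 0 := by rw [sub_mul, one_mul, hf, sub_self]
  have hgz : (1 - f) * z = z := by
    rw [hz, ← mul_assoc, ← mul_assoc, mul_sub, mul_one, hgf, sub_zero]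
  have hfz : f * z = 0 := by rw [← hgz, ← mul_assoc, mul_sub, mul_one, hf, sub_self, zero_mul]
  have hzf : z * f = z := by rw [hz, mul_assoc, hf]
  have h₁ : z * u = 0 := by
    have := congrArg ((1 - f) * ·) hu
    simpa only [← mul_assoc, mul_add, hgf, hgz, zero_add, zero_mul] using this
  have h₂ : z * s = 0 := by
    have := congrArg ((1 - f) * ·) hv
    simpa only [← mul_assoc, mul_add, hgf, hgz, zero_add, zero_mul, eq_comm] using this
  have h₃ : f * v = f * s := by rw [hv, add_mul, h₂, add_zero]
  calc z = z * u + z * f * v := by rw [hzf, ← mul_add, huv, mul_one]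
    _ = 0 := by rw [h₁, mul_assoc, h₃, ← mul_assoc, hzf, h₂, add_zero]

theorem IsRightDistributive.idempotent_central (h : IsRightDistributive A) {e : A}
    (he : e * e = e) (x : A) : e * x = x * e := by
  have h₁ := h.one_sub_mul_mul_idempotent he x
  have h₂ := h.one_sub_mul_mul_idempotent (f := 1 - e)
    (by simp only [mul_sub, sub_mul, mul_one, one_mul, he]; abel) x
  simp only [mul_sub, sub_mul, mul_one, one_mul, sub_sub_cancel] at h₁ h₂
  grind

/-- A nonzero central element whose annihilator is a completely prime ideal. -/
structure IsPrimeAnnihilated (d : A) : Prop where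
  comm : ∀ x, d * x = x * d
  ne_zero : d ≠ 0
  prime : ∀ {x y}, d * (x * y) = 0 → d * x = 0 ∨ d * y = 0

namespace IsPrimeAnnihilated
variable {d : A}

theorem mul_right (x : A) {y : A} (h : d * y = 0) : d * (y * x) = 0 := by
  rw [← mul_assoc, h, zero_mul]

theorem mul_left (hd : IsPrimeAnnihilated d) (x : A) {y : A} (h : d * y = 0) :
    d * (x * y) = 0 := by
  rw [← mul_assoc, hd.comm, mul_assoc, h, mul_zero]

theorem pow (hd : IsPrimeAnnihilated d) {x : A} : ∀ {n : ℕ}, d * x ^ n = 0 → d * x = 0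
  | 0, h => by rw [pow_zero, mul_one] at h; exact absurd h hd.ne_zero
  | n + 1, h => by
    rw [pow_succ] at h
    exact (hd.prime h).elim hd.pow id

theorem exists_mul (hn : IsNoetherian Aᵐᵒᵖ A) (hCE : IsCentrallyEssential A) {e : A}
    (he : ∀ x, e * x = x * e) (he0 : e ≠ 0) : ∃ b, IsPrimeAnnihilated (e * b) := by
  obtain ⟨_, ⟨hc, h0, b, rfl⟩, hmax⟩ := exists_maximal_rightAnnihilator hn
    (p := fun x => (∀ y, x * y = y * x) ∧ x ≠ 0 ∧ ∃ b, x = e * b)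
    ⟨e, he, he0, 1, (mul_one e).symm⟩
  refine ⟨b, hc, h0, fun {x y} hxy => ?_⟩
  by_contra! hne
  obtain ⟨c, hc₁, hc₂, hc₃⟩ := hCE.exists_central hne.1
  refine hne.2 (hmax (e * b * x * c) ⟨hc₂, hc₃, b * x * c, by simp only [mul_assoc]⟩ ?_ y ?_)
  · intro r hr
    rw [hc₂, mul_assoc (e * b), ← mul_assoc, ← hc, hr, zero_mul]
  · rw [mul_assoc, hc₁, ← mul_assoc, mul_assoc (e * b), hxy, zero_mul]

theorem exists_comaximal (hdist : IsRightDistributive A) {d' v : A} (hd : IsPrimeAnnihilated d)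
    (hd' : IsPrimeAnnihilated d') (hdv : d' * v = 0) (hv : d * v ≠ 0) :
    ∃ q, d' * q = 0 ∧ d * (1 - q) = 0 := by
  obtain ⟨x, y, r, s, hxy, hx, hy⟩ := hdist.exists_add_eq_one d d'
  have key : ∀ {z}, d * (z * v) = 0 → d * z = 0 := fun h => (hd.prime h).resolve_right hv
  refine ⟨y, ?_, ?_⟩
  · rw [hy]
    refine key ?_
    rw [← mul_assoc, ← hy, mul_assoc]
    exact hd'.mul_left _ hdv
  · rw [← hxy, add_sub_cancel_right]
    refine key ?_
    rw [← mul_assoc, hx, mul_assoc]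
    exact hd'.mul_left _ hdv

/-- If `x ≠ 0` is annihilated by the annihilator of `d`, the two annihilators agree. -/
theorem mul_eq_zero_of_annihilator_le (hn : IsNoetherian Aᵐᵒᵖ A)
    (hCE : IsCentrallyEssential A) (hdist : IsRightDistributive A) (hd : IsPrimeAnnihilated d)
    {x : A} (hx0 : x ≠ 0) (hx : ∀ i, d * i = 0 → x * i = 0) {r : A} (hr : x * r = 0) :
    d * r = 0 := by
  obtain ⟨c, hc₁, hc₂, hc₃⟩ := hCE.exists_central hx0
  obtain ⟨b, hb⟩ := exists_mul hn hCE hc₂ hc₃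
  by_contra hne
  have hr' : x * c * b * r = 0 := by
    rw [hc₂ b, mul_assoc, mul_assoc x, hc₁, ← mul_assoc x, hr, zero_mul, mul_zero]
  obtain ⟨q, hq, hdq⟩ := hd.exists_comaximal hdist hb hr' hne
  have h1 : x * c * b * (1 - q) = 0 := by
    rw [mul_assoc x, mul_assoc x]
    exact hx _ (hd.mul_left _ hdq)
  apply hb.ne_zero
  rw [mul_sub, hq, sub_zero, mul_one] at h1
  exact h1

theorem comm_of_annihilator_le (hn : IsNoetherian Aᵐᵒᵖ A)
    (hCE : IsCentrallyEssential A) (hdist : IsRightDistributive A) (hd : IsPrimeAnnihilated d)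
    {x : A} (hx : ∀ i, d * i = 0 → x * i = 0) (s : A) : s * x = x * s := by
  rcases eq_or_ne x 0 with rfl | hx0
  · simp
  obtain ⟨c, hc₁, hc₂, hc₃⟩ := hCE.exists_central hx0
  rw [← sub_eq_zero]
  by_contra hne
  refine hc₃ (hx c (mul_eq_zero_of_annihilator_le hn hCE hdist hd hne ?_ ?_))
  · intro i hi
    rw [sub_mul, mul_assoc, hx i hi, mul_assoc x, hx _ (hd.mul_left s hi), mul_zero, sub_zero]
  · rw [sub_mul, mul_assoc, ← hc₂, mul_assoc x s, ← hc₁ s, mul_assoc, sub_self]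

/-- An element congruent to `1` modulo the annihilator of `d`, lying in the annihilators of all
other elements with prime annihilator. -/
theorem exists_separating (hn : IsNoetherian Aᵐᵒᵖ A) (hdist : IsRightDistributive A)
    (hd : IsPrimeAnnihilated d) : ∃ q, d * (1 - q) = 0 ∧
      (∀ d', IsPrimeAnnihilated d' → (∃ v, d' * v = 0 ∧ d * v ≠ 0) → q * d' = 0) ∧
      ∀ x, q * (q * x) = 0 → q * x = 0 := by
  obtain ⟨q, hq, hmax⟩ := exists_maximal_rightAnnihilator hn (p := fun q => d * (1 - q) = 0)
    ⟨1, by simp⟩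
  have hmul : ∀ q', d * (1 - q') = 0 → d * (1 - q' * q) = 0 := fun q' hq' => by
    have : 1 - q' * q = (1 - q') * q + (1 - q) := by rw [sub_mul, one_mul]; abel
    rw [this, mul_add, hq, mul_right _ hq', add_zero]
  have hle : ∀ q' r, q * r = 0 → q' * q * r = 0 := fun q' r h => by rw [mul_assoc, h, mul_zero]
  refine ⟨q, hq, ?_, fun x hx => ?_⟩
  · rintro d' hd' ⟨v, hv', hv⟩
    obtain ⟨q', hq', hdq'⟩ := hd.exists_comaximal hdist hd' hv' hv
    refine hmax (q' * q) (hmul q' hdq') (hle q') d' ?_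
    rw [← hd'.comm]
    exact mul_right q hq'
  · exact hmax (q * q) (hmul q hq) (hle q) x (by rw [mul_assoc, hx])

theorem exists_left_inverse (hn : IsNoetherian Aᵐᵒᵖ A) (hCE : IsCentrallyEssential A)
    (hdist : IsRightDistributive A) (hd : IsPrimeAnnihilated d) (hdd : d * d = 0) {m : A}
    (hm : d * m ≠ 0) : ∃ a, d * (1 - a * m) = 0 := by
  obtain ⟨q, hq, hq', -⟩ := hd.exists_separating hn hdist
  set s := m * q + (1 - q) with hs
  have hsm : d * (s - m) = 0 := by
    have : s - m = (1 - m) * (1 - q) := by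
      simp only [hs, mul_sub, sub_mul, mul_one, one_mul]; abel
    rw [this]
    exact hd.mul_left _ hq
  have hds : d * s ≠ 0 := fun h => hm (by rw [mul_sub, h, zero_sub, neg_eq_zero] at hsm; exact hsm)
  have hreg : ∀ x, s * x = 0 → x = 0 := by
    intro x hx
    by_contra hx0
    obtain ⟨c, hc₁, hc₂, hc₃⟩ := hCE.exists_central hx0
    obtain ⟨b, hb⟩ := exists_mul hn hCE hc₂ hc₃
    have hsb : s * (x * c * b) = 0 := by
      rw [mul_assoc x, ← mul_assoc, hx, zero_mul]
    have := hq' _ hb ⟨s, by rw [hb.comm, hsb], hds⟩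
    rw [hs, add_mul, mul_assoc, this, mul_zero, sub_mul, this, one_mul, sub_zero, zero_add] at hsb
    exact hb.ne_zero hsb
  obtain ⟨x, ⟨hx0, hdx, hx⟩, hmax⟩ := exists_maximal_span hn
    (p := fun x => x ≠ 0 ∧ d * x = 0 ∧ ∀ i, d * i = 0 → x * i = 0)
    ⟨d, hd.ne_zero, hdd, fun _ => id⟩
  obtain ⟨u, v, w, t, huv, hu, hv⟩ := hdist.exists_add_eq_one x s
  have hdv : d * v = 0 := by
    refine (hd.prime (x := s) ?_).resolve_left hds
    rw [hv]
    exact mul_right t hdx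
  have hxw : x = s * w := by
    rw [← hu, ← add_zero (x * u), ← hx v hdv, ← mul_add, huv, mul_one]
  have hw : ∀ i, d * i = 0 → w * i = 0 := fun i hi =>
    hreg _ (by rw [← mul_assoc, ← hxw, hx i hi])
  have hcomm := comm_of_annihilator_le hn hCE hdist hd hw s
  obtain ⟨a, ha⟩ := hmax w ⟨fun h => hx0 (by rw [hxw, h, mul_zero]),
    (hd.prime (hxw ▸ hdx)).resolve_left hds, hw⟩ ⟨s, hxw.trans hcomm⟩
  have has : d * (1 - a * s) = 0 := by
    refine mul_eq_zero_of_annihilator_le hn hCE hdist hd hx0 hx ?_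
    rw [mul_sub, mul_one, ← mul_assoc, ← ha, ← hcomm, ← hxw, sub_self]
  refine ⟨a, ?_⟩
  have : 1 - a * m = (1 - a * s) + a * (s - m) := by rw [mul_sub]; abel
  rw [this, mul_add, has, hd.mul_left a hsm, add_zero]

theorem exists_right_inverse (hn : IsNoetherian Aᵐᵒᵖ A) (hCE : IsCentrallyEssential A)
    (hdist : IsRightDistributive A) (hd : IsPrimeAnnihilated d) (hdd : d * d = 0) {m : A}
    (hm : d * m ≠ 0) : ∃ a, d * (1 - m * a) = 0 := by
  obtain ⟨a, ha⟩ := exists_left_inverse hn hCE hdist hd hdd hm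
  refine ⟨a, ?_⟩
  have h : d * (m * (1 - a * m)) = 0 := hd.mul_left m ha
  have h' : m * (1 - a * m) = (1 - m * a) * m := by
    simp only [mul_sub, sub_mul, mul_one, one_mul, mul_assoc]
  rw [h'] at h
  exact (hd.prime h).resolve_right hm

/-- The annihilator of `d` is the Jacobson radical of a local ring and it is nil. -/
theorem isUnit_and_isNilpotent (hn : IsNoetherian Aᵐᵒᵖ A) (hCE : IsCentrallyEssential A)
    (hdist : IsRightDistributive A)
    (hindec : ∀ e : A, e ∈ Set.center A → e * e = e → e = 0 ∨ e = 1)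
    (hd : IsPrimeAnnihilated d) (hdd : d * d = 0) :
    (∀ v, d * v ≠ 0 → IsUnit v) ∧ ∀ x, d * x = 0 → IsNilpotent x := by
  obtain ⟨q, hq, hq', hqreg⟩ := hd.exists_separating hn hdist
  have hqtor : ∀ t v, d * v ≠ 0 → t * v = 0 → q * t = 0 := by
    intro t v hv htv
    by_contra hne
    obtain ⟨c, hc₁, hc₂, hc₃⟩ := hCE.exists_central hne
    obtain ⟨b, hb⟩ := exists_mul hn hCE hc₂ hc₃
    have hbv : q * t * c * b * v = 0 := by
      rw [hc₂ b, mul_assoc, mul_assoc (q * t), hc₁, ← mul_assoc (q * t), mul_assoc q,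
        htv, mul_zero, zero_mul, mul_zero]
    have h := hq' _ hb ⟨v, hbv, hv⟩
    refine hb.ne_zero ?_
    simp only [mul_assoc] at h ⊢
    exact hqreg _ h
  have hqpow : ∀ x, d * x = 0 → ∃ n : ℕ, q * x ^ (n + 1) = 0 := by
    intro x hx
    obtain ⟨n, hstab⟩ := exists_pow_rightAnnihilator_stable hn x
    obtain ⟨u, v, r, s, huv, hu, hv⟩ := hdist.exists_add_eq_one d (x ^ n)
    refine ⟨n, hqtor _ v (fun hdv => ?_) ?_⟩
    · have hd' : d = x ^ n * r := by
        rw [← hu, ← sub_eq_zero, ← mul_one d, mul_assoc, one_mul, ← mul_sub, ← huv,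
          add_sub_cancel_left, hdv]
      refine hd.ne_zero (hd' ▸ hstab r ?_)
      rw [pow_succ', mul_assoc, ← hd', ← hd.comm, hx]
    · rw [pow_succ', mul_assoc, hv, ← mul_assoc, ← hd.comm, hx, zero_mul]
  obtain ⟨n, hzn⟩ := hqpow _ hq
  set f := (1 - q) ^ (n + 1) with hf
  have hff : f * f = f := by
    have h : ∀ k : ℕ, (1 - q) ^ k * f = f := fun k => by
      induction k with
      | zero => rw [pow_zero, one_mul]
      | succ k ih => rw [pow_succ, mul_assoc, sub_mul, one_mul, hzn, sub_zero, ih]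
    exact h (n + 1)
  have hf0 : f = 0 := by
    refine (hindec f ?_ hff).resolve_right fun h1 => ?_
    · exact Semigroup.mem_center_iff.2 fun g => (hdist.idempotent_central hff g).symm
    · rw [h1, mul_one] at hzn
      rw [hzn, sub_zero, mul_one] at hq
      exact hd.ne_zero hq
  have hqu : IsUnit q := by
    have : IsNilpotent (1 - q) := ⟨n + 1, hf0⟩
    simpa using this.isUnit_one_sub
  have hnil : ∀ x, d * x = 0 → IsNilpotent x := fun x hx => by
    obtain ⟨k, hk⟩ := hqpow x hx
    exact ⟨k + 1, hqu.mul_right_eq_zero.1 hk⟩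
  refine ⟨fun v hv => ?_, hnil⟩
  obtain ⟨a, ha⟩ := exists_left_inverse hn hCE hdist hd hdd hv
  obtain ⟨b, hb⟩ := exists_right_inverse hn hCE hdist hd hdd hv
  have h₁ : IsUnit (a * v) := by simpa using (hnil _ ha).isUnit_one_sub
  have h₂ : IsUnit (v * b) := by simpa using (hnil _ hb).isUnit_one_sub
  obtain ⟨a', ha'⟩ := h₁.exists_left_inv
  obtain ⟨b', hb'⟩ := h₂.exists_right_inv
  rw [← mul_assoc] at ha'
  rw [mul_assoc] at hb'
  exact isUnit_iff_exists.2 ⟨b * b', hb', by rw [← left_inv_eq_right_inv ha' hb', ha']⟩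

end IsPrimeAnnihilated

/-- A ring in which every nonzero element is a power of `p` times a unit, on either side, and in
which `p` is nilpotent, is uniserial and Artinian. -/
theorem isUniserialRing_and_isArtinianBothSides_of_pow_mul_unit {p : A} (hp : IsNilpotent p)
    (hr : ∀ x : A, x ≠ 0 → ∃ (k : ℕ) (u : A), IsUnit u ∧ x = p ^ k * u)
    (hl : ∀ x : A, x ≠ 0 → ∃ (k : ℕ) (u : A), IsUnit u ∧ x = u * p ^ k) :
    IsUniserialRing A ∧ IsArtinianBothSides A := by
  classical
  obtain ⟨n, hn⟩ := hp
  have hR : ∀ I : Submodule Aᵐᵒᵖ A, ∃ k : Fin (n + 1),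
      ∀ x, x ∈ I ↔ ∃ r, x = p ^ (k : ℕ) * r := by
    intro I
    have hex : ∃ k, p ^ k ∈ I := ⟨n, hn ▸ I.zero_mem⟩
    refine ⟨⟨Nat.find hex, Nat.lt_succ_of_le (Nat.find_min' hex (hn ▸ I.zero_mem))⟩,
      fun x => ⟨fun hx => ?_, ?_⟩⟩
    · rcases eq_or_ne x 0 with rfl | hx0
      · exact ⟨0, (mul_zero _).symm⟩
      obtain ⟨k, u, ⟨u, rfl⟩, rfl⟩ := hr x hx0
      have hk : p ^ k ∈ I := by
        have := I.smul_mem (MulOpposite.op (↑u⁻¹ : A)) hx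
        rwa [MulOpposite.smul_eq_mul_unop, MulOpposite.unop_op, Units.mul_inv_cancel_right]
          at this
      obtain ⟨j, rfl⟩ := Nat.exists_eq_add_of_le (Nat.find_min' hex hk)
      exact ⟨p ^ j * u, by rw [pow_add, mul_assoc]⟩
    · rintro ⟨r, rfl⟩
      exact I.smul_mem (MulOpposite.op r) (Nat.find_spec hex)
  have hL : ∀ I : Ideal A, ∃ k : Fin (n + 1), ∀ x, x ∈ I ↔ ∃ r, x = r * p ^ (k : ℕ) := by
    intro I
    have hex : ∃ k, p ^ k ∈ I := ⟨n, hn ▸ I.zero_mem⟩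
    refine ⟨⟨Nat.find hex, Nat.lt_succ_of_le (Nat.find_min' hex (hn ▸ I.zero_mem))⟩,
      fun x => ⟨fun hx => ?_, ?_⟩⟩
    · rcases eq_or_ne x 0 with rfl | hx0
      · exact ⟨0, (zero_mul _).symm⟩
      obtain ⟨k, u, ⟨u, rfl⟩, rfl⟩ := hl x hx0
      have hk : p ^ k ∈ I := by
        have := I.mul_mem_left (↑u⁻¹ : A) hx
        rwa [Units.inv_mul_cancel_left] at this
      obtain ⟨j, rfl⟩ := Nat.exists_eq_add_of_le' (Nat.find_min' hex hk)
      exact ⟨u * p ^ j, by rw [pow_add, mul_assoc]⟩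
    · rintro ⟨r, rfl⟩
      exact I.mul_mem_left r (Nat.find_spec hex)
  choose f hf using hR
  choose g hg using hL
  have hfle : ∀ I J, f I ≤ f J → J ≤ I := fun I J h x hx => by
    obtain ⟨r, rfl⟩ := (hf J x).1 hx
    obtain ⟨j, hj⟩ := Nat.exists_eq_add_of_le h
    exact (hf I _).2 ⟨p ^ j * r, by rw [hj, pow_add, mul_assoc]⟩
  have hgle : ∀ I J, g I ≤ g J → J ≤ I := fun I J h x hx => by
    obtain ⟨r, rfl⟩ := (hg J x).1 hx
    obtain ⟨j, hj⟩ := Nat.exists_eq_add_of_le' h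
    exact (hg I _).2 ⟨r * p ^ j, by rw [hj, pow_add, mul_assoc]⟩
  have : Finite (Submodule Aᵐᵒᵖ A) := Finite.of_injective f fun I J h =>
    le_antisymm (hfle J I h.ge) (hfle I J h.le)
  have : Finite (Ideal A) := Finite.of_injective g fun I J h =>
    le_antisymm (hgle J I h.ge) (hgle I J h.le)
  exact ⟨⟨fun I J => (le_total (f J) (f I)).imp (hfle J I) (hfle I J),
    fun I J => (le_total (g J) (g I)).imp (hgle J I) (hgle I J)⟩,
    ⟨Finite.to_wellFoundedLT, Finite.to_wellFoundedLT⟩⟩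

theorem exists_pow_mul_unit {p : A} (hp : IsNilpotent p)
    (h : ∀ x : A, IsUnit x ∨ ∃ y, x = p * y) {x : A} (hx : x ≠ 0) :
    ∃ (k : ℕ) (u : A), IsUnit u ∧ x = p ^ k * u := by
  obtain ⟨n, hn⟩ := hp
  have key : ∀ k : ℕ, (∃ y, x = p ^ k * y) ∨ ∃ (k : ℕ) (u : A), IsUnit u ∧ x = p ^ k * u := by
    intro k
    induction k with
    | zero => exact Or.inl ⟨x, by rw [pow_zero, one_mul]⟩
    | succ k ih =>
      rcases ih with ⟨y, hy⟩ | ih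
      · rcases h y with hu | ⟨z, rfl⟩
        · exact Or.inr ⟨k, y, hu, hy⟩
        · exact Or.inl ⟨z, by rw [hy, pow_succ, mul_assoc]⟩
      · exact Or.inr ih
  refine (key n).resolve_left ?_
  rintro ⟨y, rfl⟩
  exact hx (by rw [hn, zero_mul])

theorem exists_unit_mul_pow {p : A} (hp : IsNilpotent p)
    (h : ∀ x : A, IsUnit x ∨ ∃ y, x = y * p) {x : A} (hx : x ≠ 0) :
    ∃ (k : ℕ) (u : A), IsUnit u ∧ x = u * p ^ k := by
  have hp' : IsNilpotent (MulOpposite.op p) := by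
    obtain ⟨n, hn⟩ := hp
    exact ⟨n, by rw [← MulOpposite.op_pow, hn, MulOpposite.op_zero]⟩
  have h' : ∀ y : Aᵐᵒᵖ, IsUnit y ∨ ∃ z, y = MulOpposite.op p * z := fun y =>
    (h y.unop).imp (fun hu => by simpa using hu.op) fun ⟨z, hz⟩ =>
      ⟨MulOpposite.op z, by rw [← MulOpposite.op_mul, ← hz, MulOpposite.op_unop]⟩
  obtain ⟨k, u, hu, hxu⟩ := exists_pow_mul_unit hp' h' (x := MulOpposite.op x) (by simpa using hx)
  exact ⟨k, u.unop, hu.unop, by simpa using congrArg MulOpposite.unop hxu⟩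

namespace IsPrimeAnnihilated
variable {d : A}

/-- If the annihilator of `d` is `p * A`, it is also `A * p`. -/
theorem exists_mul_generator (hn : IsNoetherian Aᵐᵒᵖ A) (hCE : IsCentrallyEssential A)
    (hdist : IsRightDistributive A) (hd : IsPrimeAnnihilated d)
    (hunit : ∀ v, d * v ≠ 0 → IsUnit v) {p : A} (hp : IsNilpotent p) (hp0 : p ≠ 0)
    (hdp : d * p = 0) (hgen : ∀ x, d * x = 0 → ∃ y, x = p * y) (x : A) (hx : d * x = 0) :
    ∃ y, x = y * p := by
  obtain ⟨n, hn0, hn1⟩ : ∃ n : ℕ, p ^ (n + 1) ≠ 0 ∧ p ^ (n + 2) = 0 := by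
    classical
    have h0 : Nat.find hp ≠ 0 := fun h => hp0 (by
      have := Nat.find_spec hp
      rw [h, pow_zero] at this
      rw [← mul_one p, this, mul_zero])
    have h1 : Nat.find hp ≠ 1 := fun h => hp0 (by
      have := Nat.find_spec hp
      rwa [h, pow_one] at this)
    obtain ⟨n, hn⟩ := Nat.exists_eq_add_of_le' (show 2 ≤ Nat.find hp by omega)
    refine ⟨n, Nat.find_min hp (by omega), ?_⟩
    rw [← hn]
    exact Nat.find_spec hp
  -- left multiplication can be moved across powers of `p`
  have hmove : ∀ (k : ℕ) (a : A), ∃ b, a * p ^ k = p ^ k * b := by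
    intro k
    induction k with
    | zero => exact fun a => ⟨a, by rw [pow_zero, one_mul, mul_one]⟩
    | succ k ih =>
      intro a
      obtain ⟨b, hb⟩ := ih a
      obtain ⟨c, hc⟩ := hgen (b * p) (hd.mul_left b hdp)
      exact ⟨c, by rw [pow_succ, ← mul_assoc, hb, mul_assoc, hc, mul_assoc]⟩
  have htop : ∀ a s, s * (p ^ (n + 1) * a) = p ^ (n + 1) * a * s := fun a =>
    comm_of_annihilator_le hn hCE hdist hd fun i hi => by
      obtain ⟨y, hy⟩ := hgen (a * i) (hd.mul_left a hi)
      rw [mul_assoc, hy, ← mul_assoc, ← pow_succ, hn1, zero_mul]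
  have hstep : ∀ a, ∃ b c, p * a = b * p + p ^ 2 * c := by
    intro a
    obtain ⟨b, hb⟩ := hmove n a
    obtain ⟨b', hb'⟩ := hgen (b * p) (hd.mul_left b hdp)
    have h : p ^ (n + 1) * (a - b') = 0 := by
      have h1 := htop 1 a
      rw [mul_one, pow_succ, ← mul_assoc, hb, mul_assoc, hb', ← mul_assoc] at h1
      rw [mul_sub, pow_succ, h1, sub_self]
    have hda : d * (a - b') = 0 := by
      by_contra hne
      exact hn0 ((hunit _ hne).mul_left_eq_zero.1 h)
    obtain ⟨c, hc⟩ := hgen _ hda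
    refine ⟨b, c, ?_⟩
    rw [hb', sq, mul_assoc, ← hc, mul_sub, add_sub_cancel]
  have hind : ∀ (k : ℕ) (a : A), ∃ b c, p * a = b * p + p ^ (k + 1) * c := by
    intro k a
    induction k with
    | zero => exact ⟨0, a, by rw [zero_mul, zero_add, pow_one]⟩
    | succ k ih =>
      obtain ⟨b, c, hbc⟩ := ih
      obtain ⟨b', c', hbc'⟩ := hstep c
      refine ⟨b + p ^ k * b', c', ?_⟩
      rw [hbc, pow_succ, mul_assoc, hbc', mul_add, add_mul, ← mul_assoc, ← mul_assoc, ← pow_add,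
        add_assoc]
  obtain ⟨a, rfl⟩ := hgen x hx
  obtain ⟨b, c, hbc⟩ := hind (n + 1) a
  exact ⟨b, by rw [hbc, hn1, zero_mul, add_zero]⟩

end IsPrimeAnnihilated
end AnnihilatorPrime

/-- A right distributive, right Noetherian, centrally essential, indecomposable ring
which is not semiprime is a uniserial (left and right) Artinian ring. -/
theorem uniserial_artinian_of_not_semiprime {A : Type*} [Ring A] [Nontrivial A]
    (hdist : IsRightDistributive A)
    (hnoeth : IsNoetherian Aᵐᵒᵖ A)
    (hCE : IsCentrallyEssential A)
    (hindec : ∀ e : A, e ∈ Set.center A → e * e = e → e = 0 ∨ e = 1)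
    (hnotsp : ∃ a : A, a ≠ 0 ∧ ∀ x : A, a * x * a = 0) :
    IsUniserialRing A ∧ IsArtinianBothSides A := by
  obtain ⟨a, ha, haxa⟩ := hnotsp
  obtain ⟨c, hc₁, hc₂, hc₃⟩ := hCE.exists_central ha
  obtain ⟨b, hd⟩ := IsPrimeAnnihilated.exists_mul hnoeth hCE hc₂ hc₃
  have hdd : a * c * b * (a * c * b) = 0 := by
    rw [mul_assoc a c b, ← mul_assoc, haxa, zero_mul]
  generalize a * c * b = d at hd hdd
  obtain ⟨hunit, hnil⟩ := hd.isUnit_and_isNilpotent hnoeth hCE hdist hindec hdd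
  obtain ⟨p, hdp, hmax⟩ := exists_maximal_span hnoeth (p := fun x => d * x = 0) ⟨d, hdd⟩
  have hgen : ∀ x, d * x = 0 → ∃ y, x = p * y := by
    intro x hx
    obtain ⟨u, v, r, s, huv, hu, hv⟩ := hdist.exists_add_eq_one x p
    by_cases hdu : d * u = 0
    · have hdv : d * v ≠ 0 := fun h => hd.ne_zero (by
        rw [← mul_one d, ← huv, mul_add, hdu, h, add_zero])
      obtain ⟨w, hw⟩ := (hunit v hdv).exists_right_inv
      exact hmax x hx ⟨s * w, by rw [← mul_assoc, ← hv, mul_assoc, hw, mul_one]⟩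
    · obtain ⟨w, hw⟩ := (hunit u hdu).exists_right_inv
      exact ⟨r * w, by rw [← mul_assoc, ← hu, mul_assoc, hw, mul_one]⟩
  have hp0 : p ≠ 0 := by
    rintro rfl
    obtain ⟨y, hy⟩ := hgen d hdd
    exact hd.ne_zero (by rw [hy, zero_mul])
  have hgen' := hd.exists_mul_generator hnoeth hCE hdist hunit (hnil p hdp) hp0 hdp hgen
  refine isUniserialRing_and_isArtinianBothSides_of_pow_mul_unit (hnil p hdp)
    (fun x hx => exists_pow_mul_unit (hnil p hdp) (fun y => ?_) hx)
    (fun x hx => exists_unit_mul_pow (hnil p hdp) (fun y => ?_) hx)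
  · exact (em (d * y = 0)).symm.imp (hunit y) (hgen y)
  · exact (em (d * y = 0)).symm.imp (hunit y) (hgen' y)
end

section
/- A ring A is a right distributive, left Noetherian, centrally essential ring if and only if A is isomorphic to a finite direct product A₁ × ⋯ × Aₙ of rings, where each Aᵢ is either a uniserial Artinian centrally essential ring or a commutative Dedekind domain. -/
/-- The commutative ring structure obtained from a ring whose multiplication is
commutative. -/
def Ring.commRingOfComm (A : Type*) [inst : Ring A] (h : ∀ x y : A, x * y = y * x) :
    CommRing A := { inst with mul_comm := h }

/-- A (possibly noncommutative) ring is a *commutative Dedekind domain* if its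
multiplication is commutative and, regarded as a commutative ring, it is a Dedekind
domain. -/
def IsCommDedekindDomain (A : Type*) [Ring A] : Prop :=
  ∃ h : ∀ x y : A, x * y = y * x, @IsDedekindDomain A (Ring.commRingOfComm A h)

/-- A ring which is either a uniserial Artinian centrally essential ring or a
commutative Dedekind domain. -/
def IsGoodFactor (R : Type*) [Ring R] : Prop :=
  (IsUniserialRing R ∧ IsArtinianBothSides R ∧ IsCentrallyEssential R) ∨
    IsCommDedekindDomain R

universe u


/-- Elementwise form of right distributivity: any two elements `a`, `b` admit a decomposition
`u + v = 1` of the identity with `a * u ∈ bA` and `b * v ∈ aA`. -/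
def HasDistribWitnesses (A : Type*) [Ring A] : Prop :=
  ∀ a b : A, ∃ u v r s : A, u + v = 1 ∧ a * u = b * r ∧ b * v = a * s

theorem mem_rightSpan_singleton {A : Type*} [Ring A] {a x : A} :
    x ∈ Submodule.span Aᵐᵒᵖ {a} ↔ ∃ r, x = a * r := by
  rw [Submodule.mem_span_singleton]
  constructor
  · rintro ⟨r, rfl⟩
    exact ⟨r.unop, rfl⟩
  · rintro ⟨r, rfl⟩
    exact ⟨MulOpposite.op r, rfl⟩

theorem Submodule.mul_mem_right {A : Type*} [Ring A] (I : Submodule Aᵐᵒᵖ A) {a : A} (h : a ∈ I)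
    (r : A) : a * r ∈ I :=
  I.smul_mem (MulOpposite.op r) h

theorem isRightDistributive_iff {A : Type*} [Ring A] :
    IsRightDistributive A ↔ HasDistribWitnesses A := by
  constructor
  · intro h a b
    have key : a + b ∈ Submodule.span Aᵐᵒᵖ {a + b} ⊓
        (Submodule.span Aᵐᵒᵖ {a} ⊔ Submodule.span Aᵐᵒᵖ {b}) :=
      ⟨Submodule.mem_span_singleton_self _, Submodule.add_mem_sup
        (Submodule.mem_span_singleton_self _) (Submodule.mem_span_singleton_self _)⟩
    rw [h, Submodule.mem_sup] at key
    obtain ⟨y, ⟨hy1, hy2⟩, z, ⟨hz1, hz2⟩, hyz⟩ := key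
    obtain ⟨p, hp⟩ := mem_rightSpan_singleton.1 hy1
    obtain ⟨p', hp'⟩ := mem_rightSpan_singleton.1 hy2
    obtain ⟨q, hq⟩ := mem_rightSpan_singleton.1 hz1
    obtain ⟨q', hq'⟩ := mem_rightSpan_singleton.1 hz2
    have hpp : (a + b) * p = a * p' := hp.symm.trans hp'
    have hqq : (a + b) * q = b * q' := hq.symm.trans hq'
    have hs : (a + b) * (p + q) = a + b := by rw [mul_add, ← hp, ← hq, hyz]
    refine ⟨q, 1 - q, q' - q, p' - p - (1 - p - q), by abel, ?_, ?_⟩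
    · rw [mul_sub, ← hqq]; noncomm_ring
    · rw [mul_sub a, mul_sub a, ← hpp]
      have : a + b - (a + b) * (p + q) = 0 := by rw [hs, sub_self]
      rw [← sub_eq_zero, ← this]
      noncomm_ring
  · intro h I J K
    refine le_antisymm ?_ (sup_le (inf_le_inf_left _ le_sup_left) (inf_le_inf_left _ le_sup_right))
    rintro z ⟨hzI, hz⟩
    obtain ⟨j, hj, k, hk, rfl⟩ := Submodule.mem_sup.1 hz
    obtain ⟨u, v, r, s, huv, hu, hv⟩ := h j k
    have e : j + k = (j + k) * v + (j + k) * u := by rw [← mul_add, add_comm v, huv, mul_one]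
    rw [e]
    refine Submodule.add_mem_sup ⟨I.mul_mem_right hzI v, ?_⟩ ⟨I.mul_mem_right hzI u, ?_⟩
    · rw [add_mul, hv]
      exact J.add_mem (J.mul_mem_right hj v) (J.mul_mem_right hj s)
    · rw [add_mul, hu]
      exact K.add_mem (K.mul_mem_right hk r) (K.mul_mem_right hk u)

theorem HasDistribWitnesses.of_surjective {A B : Type*} [Ring A] [Ring B]
    (h : HasDistribWitnesses A) (f : A →+* B) (hf : Function.Surjective f) :
    HasDistribWitnesses B := by
  intro a b
  obtain ⟨a, rfl⟩ := hf a
  obtain ⟨b, rfl⟩ := hf b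
  obtain ⟨u, v, r, s, huv, hu, hv⟩ := h a b
  exact ⟨f u, f v, f r, f s, by rw [← map_add, huv, map_one], by rw [← map_mul, hu, map_mul],
    by rw [← map_mul, hv, map_mul]⟩

theorem HasDistribWitnesses.pi {ι : Type*} {B : ι → Type*} [∀ i, Ring (B i)]
    (h : ∀ i, HasDistribWitnesses (B i)) : HasDistribWitnesses (∀ i, B i) := by
  intro a b
  choose u v r s huv hu hv using fun i => h i (a i) (b i)
  exact ⟨u, v, r, s, funext huv, funext hu, funext hv⟩

theorem HasDistribWitnesses.of_isUniserialRing {A : Type*} [Ring A] (h : IsUniserialRing A) :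
    HasDistribWitnesses A := by
  intro a b
  rcases h.1 (Submodule.span Aᵐᵒᵖ {a}) (Submodule.span Aᵐᵒᵖ {b}) with hab | hab
  · obtain ⟨r, hr⟩ := mem_rightSpan_singleton.1 (hab (Submodule.mem_span_singleton_self a))
    exact ⟨1, 0, r, 0, add_zero 1, by simpa using hr, by simp⟩
  · obtain ⟨r, hr⟩ := mem_rightSpan_singleton.1 (hab (Submodule.mem_span_singleton_self b))
    exact ⟨0, 1, 0, r, zero_add 1, by simp, by simpa using hr⟩

theorem HasDistribWitnesses.of_isDedekindDomain {R : Type*} [CommRing R] [IsDedekindDomain R] :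
    HasDistribWitnesses R := by
  intro a b
  by_cases ha : a = 0
  · exact ⟨1, 0, 0, 0, add_zero 1, by simp [ha], by simp⟩
  obtain ⟨J, hJ⟩ : Ideal.span {a, b} ∣ Ideal.span {a} :=
    Ideal.dvd_iff_le.2 (Ideal.span_mono (by simp))
  obtain ⟨K, hK⟩ : Ideal.span {a, b} ∣ Ideal.span {b} :=
    Ideal.dvd_iff_le.2 (Ideal.span_mono (by simp))
  have hI : Ideal.span {a, b} ≠ ⊥ := fun h => ha <| by
    simpa [h] using Ideal.subset_span (α := R) (s := {a, b}) (Set.mem_insert a {b})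
  have hJK : J ⊔ K = 1 := by
    apply mul_left_cancel₀ hI
    rw [Ideal.mul_sup, ← hJ, ← hK, mul_one, ← Ideal.span_union]
    rfl
  obtain ⟨j, hj, k, hk, hjk⟩ := Submodule.mem_sup.1
    (show (1 : R) ∈ J ⊔ K by rw [hJK, Ideal.one_eq_top]; trivial)
  have h1 : a * k ∈ Ideal.span {b} := by
    have hmem := Ideal.mul_mem_mul (Ideal.mem_span_singleton_self a) hk
    have heq : Ideal.span {a} * K = Ideal.span {b} * J := by
      rw [hJ, hK, mul_right_comm]
    exact Ideal.mul_le_left (heq ▸ hmem)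
  have h2 : b * j ∈ Ideal.span {a} := by
    have hmem := Ideal.mul_mem_mul (Ideal.mem_span_singleton_self b) hj
    have heq : Ideal.span {b} * J = Ideal.span {a} * K := by
      rw [hK, hJ, mul_right_comm]
    exact Ideal.mul_le_left (heq ▸ hmem)
  obtain ⟨r, hr⟩ := Ideal.mem_span_singleton.1 h1
  obtain ⟨s, hs⟩ := Ideal.mem_span_singleton.1 h2
  exact ⟨k, j, r, s, by rw [add_comm, hjk], hr, hs⟩

theorem isDedekindDomain_of_hasDistribWitnesses {R : Type*} [CommRing R] [IsDomain R]
    [IsNoetherianRing R] (h : HasDistribWitnesses R) : IsDedekindDomain R := by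
  have : IsDedekindDomainDvr R := by
    refine { is_dvr_at_nonzero_prime := fun P hP hPrime => ?_ }
    refine ((IsDiscreteValuationRing.TFAE (Localization.AtPrime P)
      (IsLocalization.AtPrime.not_isField R hP _)).out 0 1).2 ?_
    rw [ValuationRing.iff_dvd_total]
    refine ⟨fun x y => ?_⟩
    obtain ⟨a, s, rfl⟩ := IsLocalization.exists_mk'_eq P.primeCompl x
    obtain ⟨b, t, rfl⟩ := IsLocalization.exists_mk'_eq P.primeCompl y
    have dvd_iff : ∀ (c d : R) (s t : P.primeCompl),
        algebraMap R (Localization.AtPrime P) c ∣ algebraMap R (Localization.AtPrime P) d →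
        IsLocalization.mk' (Localization.AtPrime P) c s ∣
          IsLocalization.mk' (Localization.AtPrime P) d t := fun c d s t hcd => by
      rw [IsLocalization.mk'_eq_mul_mk'_one c, IsLocalization.mk'_eq_mul_mk'_one d]
      have hu : IsUnit (IsLocalization.mk' (Localization.AtPrime P) 1 s) :=
        IsUnit.of_mul_eq_one (algebraMap R _ s) (by rw [IsLocalization.mk'_spec, map_one])
      exact hu.mul_right_dvd.2 (hcd.mul_right _)
    obtain ⟨u, v, r, w, huv, hu, hv⟩ := h a b
    have hmem : u ∉ P ∨ v ∉ P := by
      by_contra hcon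
      push Not at hcon
      exact hPrime.ne_top ((Ideal.eq_top_iff_one P).2 (huv ▸ P.add_mem hcon.1 hcon.2))
    rcases hmem with hmem | hmem
    · right
      apply dvd_iff
      have hunit := IsLocalization.map_units (Localization.AtPrime P) (⟨u, hmem⟩ : P.primeCompl)
      rw [← hunit.dvd_mul_right, ← map_mul, hu, map_mul]
      exact dvd_mul_right _ _
    · left
      apply dvd_iff
      have hunit := IsLocalization.map_units (Localization.AtPrime P) (⟨v, hmem⟩ : P.primeCompl)
      rw [← hunit.dvd_mul_right, ← map_mul, hv, map_mul]
      exact dvd_mul_right _ _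
  infer_instance

theorem IsCentrallyEssential.of_comm {A : Type*} [Ring A] (h : ∀ x y : A, x * y = y * x) :
    IsCentrallyEssential A := by
  intro a ha
  have hc : ∀ x : A, x ∈ Set.center A := fun x =>
    Semigroup.mem_center_iff.2 fun y => h y x
  have : Nontrivial A := ⟨a, 0, ha⟩
  exact ⟨1, a, hc 1, hc a, one_ne_zero, ha, mul_one a⟩

theorem IsCentrallyEssential.pi {ι : Type*} {B : ι → Type*} [∀ i, Ring (B i)]
    (h : ∀ i, IsCentrallyEssential (B i)) : IsCentrallyEssential (∀ i, B i) := by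
  classical
  intro a ha
  obtain ⟨i, hi⟩ := Function.ne_iff.1 ha
  obtain ⟨c, d, hc, hd, hc0, hd0, hcd⟩ := h i (a i) hi
  have hcen : ∀ x ∈ Set.center (B i), Pi.single i x ∈ Set.center (∀ i, B i) := fun x hx =>
    Semigroup.mem_center_iff.2 fun g => funext fun j => by
      rcases eq_or_ne j i with rfl | hj
      · simpa using Semigroup.mem_center_iff.1 hx (g j)
      · simp [hj]
  refine ⟨Pi.single i c, Pi.single i d, hcen c hc, hcen d hd, by simpa, by simpa, ?_⟩
  funext j
  rcases eq_or_ne j i with rfl | hj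
  · simpa using hcd
  · simp [hj]

theorem IsCentrallyEssential.of_ringEquiv {A B : Type*} [Ring A] [Ring B] (e : A ≃+* B)
    (h : IsCentrallyEssential A) : IsCentrallyEssential B := by
  intro b hb
  obtain ⟨c, d, hc, hd, hc0, hd0, hcd⟩ := h (e.symm b) (by simpa)
  have hcen : ∀ x ∈ Set.center A, e x ∈ Set.center B := fun x hx =>
    Semigroup.mem_center_iff.2 fun g => by
      simpa using congrArg e (Semigroup.mem_center_iff.1 hx (e.symm g))
  exact ⟨e c, e d, hcen c hc, hcen d hd, by simpa, by simpa, by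
    simpa using congrArg e hcd⟩

theorem IsGoodFactor.properties {R : Type*} [Ring R] (h : IsGoodFactor R) :
    HasDistribWitnesses R ∧ IsNoetherianRing R ∧ IsCentrallyEssential R := by
  rcases h with ⟨hu, ⟨ha, -⟩, hc⟩ | ⟨hcomm, hD⟩
  · have : IsArtinianRing R := ha
    exact ⟨.of_isUniserialRing hu, inferInstance, hc⟩
  · exact ⟨@HasDistribWitnesses.of_isDedekindDomain R (Ring.commRingOfComm R hcomm) hD,
      @IsDedekindRing.toIsNoetherian R (Ring.commRingOfComm R hcomm) hD.toIsDedekindRing,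
      .of_comm hcomm⟩

theorem IsCentrallyEssential.mul_mul_eq_zero {A : Type*} [Ring A] (hC : IsCentrallyEssential A)
    {e f : A} (he : e * e = e) (hf : f * f = f) (hfe : f * e = 0) (x : A) : e * x * f = 0 := by
  by_contra hne
  obtain ⟨c, d, hc, hd, -, hd0, hcd⟩ := hC _ hne
  have hed : e * d = d := by rw [← hcd]; simp only [← mul_assoc, he]
  have hdf : d * f = d := by
    rw [← hcd, mul_assoc, ← Semigroup.mem_center_iff.1 hc f, ← mul_assoc, mul_assoc _ f f, hf]
  apply hd0
  calc d = e * d := hed.symm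
    _ = d * f * e := by rw [hdf, Semigroup.mem_center_iff.1 hd e]
    _ = 0 := by rw [mul_assoc, hfe, mul_zero]

theorem IsCentrallyEssential.idempotent_mem_center {A : Type*} [Ring A]
    (hC : IsCentrallyEssential A) {e : A} (he : IsIdempotentElem e) : e ∈ Set.center A := by
  refine Semigroup.mem_center_iff.2 fun x => ?_
  have hf := he.one_sub
  have h1 := hC.mul_mul_eq_zero he hf he.one_sub_mul_self x
  have h2 := hC.mul_mul_eq_zero hf he he.mul_one_sub_self x
  rw [mul_sub, mul_one, sub_eq_zero] at h1
  rw [sub_mul, sub_mul, one_mul, sub_eq_zero] at h2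
  rw [h1, h2]

/-- If each element of a left ideal `X` stable under right multiplication is annihilated by some
`u` acting as the identity on `Y`, then a single such `u` annihilates all of `X`. -/
theorem exists_forall_mul_eq_zero {A : Type*} [Ring A] [IsNoetherianRing A] (X : Ideal A)
    (hX : ∀ x ∈ X, ∀ a, x * a ∈ X) (Y : Set A)
    (h : ∀ x ∈ X, ∃ u, x * u = 0 ∧ ∀ y ∈ Y, y * u = y) :
    ∃ u, (∀ x ∈ X, x * u = 0) ∧ ∀ y ∈ Y, y * u = y := by
  let K : A → Ideal A := fun u => X ⊓ LinearMap.ker (LinearMap.toSpanSingleton A A u)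
  have hK : ∀ u x, x ∈ K u ↔ x ∈ X ∧ x * u = 0 := fun u x => by
    simp [K, LinearMap.toSpanSingleton_apply]
  obtain ⟨_, ⟨u, hu, rfl⟩, hmax⟩ := set_has_maximal_iff_noetherian.2 ‹IsNoetherianRing A›
    (K '' {u | ∀ y ∈ Y, y * u = y}) ⟨_, 1, fun y _ => mul_one y, rfl⟩
  refine ⟨u, fun x hx => ?_, hu⟩
  obtain ⟨w, hw, hwY⟩ := h (x * u) (hX x hx u)
  by_contra hxu
  refine hmax (K (u * w)) ⟨u * w, fun y hy => by rw [← mul_assoc, hu y hy, hwY y hy], rfl⟩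
    (lt_of_le_of_ne ?_ fun heq => hxu ?_)
  · intro z hz
    rw [hK] at hz ⊢
    exact ⟨hz.1, by rw [← mul_assoc, hz.2, zero_mul]⟩
  · have : x ∈ K (u * w) := (hK _ _).2 ⟨hx, by rw [← mul_assoc, hw]⟩
    rw [← heq] at this
    exact ((hK _ _).1 this).2

/-- If left ideals `X` and `Y` stable under right multiplication satisfy `xA ∩ yA = 0` for all
`x ∈ X`, `y ∈ Y`, then right distributivity provides `u` with `X * u = 0` acting as the identity
on `Y`. -/
theorem HasDistribWitnesses.exists_separating {A : Type*} [Ring A] [IsNoetherianRing A]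
    (hW : HasDistribWitnesses A) (X Y : Ideal A) (hX : ∀ x ∈ X, ∀ a, x * a ∈ X)
    (hY : ∀ y ∈ Y, ∀ a, y * a ∈ Y) (h : Disjoint X Y) :
    ∃ u, (∀ x ∈ X, x * u = 0) ∧ ∀ y ∈ Y, y * u = y := by
  rw [Submodule.disjoint_def] at h
  have h1 : ∀ y ∈ Y, ∃ v, y * v = 0 ∧ ∀ x ∈ X, x * v = x := by
    intro y hy
    obtain ⟨u, hu, huy⟩ := exists_forall_mul_eq_zero X hX {y} fun x hx => by
      obtain ⟨u, v, r, s, huv, hu, hv⟩ := hW x y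
      refine ⟨u, h _ (hX x hx u) (hu ▸ hY y hy r), ?_⟩
      intro y' hy'
      rw [Set.mem_singleton_iff.1 hy']
      have hv0 : y * v = 0 := h _ (hv ▸ hX x hx s) (hY y hy v)
      rw [eq_sub_of_add_eq huv, mul_sub, mul_one, hv0, sub_zero]
    exact ⟨1 - u, by rw [mul_sub, mul_one, huy y rfl, sub_self],
      fun x hx => by rw [mul_sub, mul_one, hu x hx, sub_zero]⟩
  obtain ⟨v, hv, hvX⟩ := exists_forall_mul_eq_zero Y hY X h1
  exact ⟨1 - v, fun x hx => by rw [mul_sub, mul_one, hvX x hx, sub_self],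
    fun y hy => by rw [mul_sub, mul_one, hv y hy, sub_zero]⟩

theorem exists_pow_mul_eq_zero_imp {A : Type*} [Ring A] [IsNoetherianRing A] (a : A) :
    ∃ n : ℕ, n ≠ 0 ∧ ∀ x, x * a ^ n * a ^ n = 0 → x * a ^ n = 0 := by
  let f : ℕ →o Ideal A :=
    ⟨fun n => LinearMap.ker (LinearMap.toSpanSingleton A A (a ^ n)), fun m n hmn x hx => by
      simp only [LinearMap.mem_ker, LinearMap.toSpanSingleton_apply, smul_eq_mul] at hx ⊢
      rw [← Nat.add_sub_cancel' hmn, pow_add, ← mul_assoc, hx, zero_mul]⟩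
  have hf : ∀ n x, x ∈ f n ↔ x * a ^ n = 0 := fun n x => by
    change x ∈ LinearMap.ker _ ↔ _
    simp
  obtain ⟨N, hN⟩ := monotone_stabilizes_iff_noetherian.2 ‹IsNoetherianRing A› f
  refine ⟨N + 1, N.succ_ne_zero, fun x hx => ?_⟩
  rw [mul_assoc, ← pow_add, ← hf, ← hN _ (by omega), hN (N + 1) (by omega), hf] at hx
  exact hx

theorem HasDistribWitnesses.isNilpotent_or_regular_of_mem_center {A : Type*} [Ring A]
    [IsNoetherianRing A] (hW : HasDistribWitnesses A)
    (hI : ∀ e : A, IsIdempotentElem e → e = 0 ∨ e = 1) {c : A} (hc : c ∈ Set.center A) :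
    IsNilpotent c ∨ ∀ x, x * c = 0 → x = 0 := by
  obtain ⟨n, hn, hstab⟩ := exists_pow_mul_eq_zero_imp c
  have hcn : c ^ n ∈ Set.center A := Subsemiring.pow_mem (Subsemiring.center A) hc n
  have hcomm : ∀ g, g * c ^ n = c ^ n * g := Semigroup.mem_center_iff.1 hcn
  let X : Ideal A := LinearMap.ker (LinearMap.toSpanSingleton A A (c ^ n))
  have hX : ∀ x, x ∈ X ↔ x * c ^ n = 0 := fun x => by simp [X]
  obtain ⟨u, hu, huY⟩ := hW.exists_separating X (Ideal.span {c ^ n})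
    (fun x hx a => by
      rw [hX] at hx ⊢
      rw [mul_assoc, hcomm, ← mul_assoc, hx, zero_mul])
    (fun y hy a => by
      obtain ⟨b, rfl⟩ := Ideal.mem_span_singleton'.1 hy
      exact Ideal.mem_span_singleton'.2 ⟨b * a, by rw [mul_assoc, hcomm, mul_assoc]⟩)
    (Submodule.disjoint_def.2 fun x hx hy => by
      obtain ⟨b, rfl⟩ := Ideal.mem_span_singleton'.1 hy
      exact hstab b ((hX _).1 hx))
  have hmem : 1 - u ∈ X := (hX _).2 <| by
    rw [hcomm, mul_sub, mul_one, huY _ (Ideal.mem_span_singleton_self _), sub_self]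
  have hidem : IsIdempotentElem u := by
    have := hu _ hmem
    rw [sub_mul, one_mul, sub_eq_zero] at this
    exact this.symm
  rcases hI u hidem with rfl | rfl
  · left
    exact ⟨n, by simpa using (huY _ (Ideal.mem_span_singleton_self _)).symm⟩
  · right
    intro x hx
    have : x ∈ X := (hX _).2 <| by
      obtain ⟨m, rfl⟩ := Nat.exists_eq_succ_of_ne_zero hn
      rw [pow_succ', ← mul_assoc, hx, zero_mul]
    simpa using hu x this

/-- The annihilator of the set of central nilpotent elements. -/
def centralNilAnnihilator (A : Type*) [Ring A] : Ideal A where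
  carrier := {a | ∀ z ∈ Set.center A, IsNilpotent z → a * z = 0}
  add_mem' := fun ha hb z hz hn => by rw [add_mul, ha z hz hn, hb z hz hn, add_zero]
  zero_mem' := fun z _ _ => zero_mul z
  smul_mem' := fun c a ha z hz hn => by rw [smul_eq_mul, mul_assoc, ha z hz hn, mul_zero]

theorem mul_mem_centralNilAnnihilator {A : Type*} [Ring A] {a : A}
    (ha : a ∈ centralNilAnnihilator A) (b : A) : a * b ∈ centralNilAnnihilator A :=
  fun z hz hn => by
    rw [mul_assoc, Semigroup.mem_center_iff.1 hz, ← mul_assoc, ha z hz hn, zero_mul]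

theorem IsCentrallyEssential.mul_comm_of_mem_centralNilAnnihilator {A : Type*} [Ring A]
    (hC : IsCentrallyEssential A)
    (hD : ∀ c ∈ Set.center A, IsNilpotent c ∨ ∀ x, x * c = 0 → x = 0)
    {s : A} (hs : s ∈ centralNilAnnihilator A) (g : A) : g * s = s * g := by
  rcases eq_or_ne s 0 with rfl | hs0
  · simp
  obtain ⟨c, d, hc, hd, -, hd0, hcd⟩ := hC s hs0
  rcases hD c hc with hn | hreg
  · exact absurd (hcd.symm.trans (hs c hc hn)) hd0
  · refine sub_eq_zero.1 (hreg _ ?_)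
    rw [sub_mul, mul_assoc, hcd, mul_assoc, Semigroup.mem_center_iff.1 hc g, ← mul_assoc, hcd,
      Semigroup.mem_center_iff.1 hd g, sub_self]

theorem IsCentrallyEssential.exists_mul_mem_centralNilAnnihilator {A : Type*} [Ring A]
    [IsNoetherianRing A] (hC : IsCentrallyEssential A) {b : A} (hb : b ≠ 0) :
    ∃ z ∈ Set.center A, b * z ∈ centralNilAnnihilator A ∧ b * z ≠ 0 := by
  obtain ⟨c, d, hc, hd, -, hd0, hcd⟩ := hC b hb
  let K : A → Ideal A := fun q => LinearMap.ker (LinearMap.toSpanSingleton A A (d * q))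
  have hK : ∀ q x, x ∈ K q ↔ x * (d * q) = 0 := fun q x => by simp [K]
  obtain ⟨_, ⟨q, ⟨hq, hdq⟩, rfl⟩, hmax⟩ := set_has_maximal_iff_noetherian.2 ‹IsNoetherianRing A›
    (K '' {q | q ∈ Set.center A ∧ d * q ≠ 0})
    ⟨_, 1, ⟨Set.one_mem_center, by rwa [mul_one]⟩, rfl⟩
  refine ⟨c * q, Set.mul_mem_center hc hq, ?_, by rwa [← mul_assoc, hcd]⟩
  rw [← mul_assoc, hcd]
  intro z hz ⟨k, hk⟩
  by_contra hdqz
  have hpow : ∀ i : ℕ, d * (q * z ^ i) ≠ 0 := by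
    intro i
    induction i with
    | zero => simpa using hdq
    | succ i ih =>
      intro h0
      have hzi : z ^ i ∈ Set.center A := Subsemiring.pow_mem (Subsemiring.center A) hz i
      have hle : K q ≤ K (q * z ^ i) := fun x hx => by
        rw [hK] at hx ⊢
        rw [← mul_assoc d, ← mul_assoc, hx, zero_mul]
      have heq : K q = K (q * z ^ i) := by
        by_contra hne
        exact hmax _ ⟨_, ⟨Set.mul_mem_center hq hzi, ih⟩, rfl⟩ (lt_of_le_of_ne hle hne)
      have hmem : z ∈ K (q * z ^ i) := (hK _ _).2 <| by
        rw [← Semigroup.mem_center_iff.1 hz, mul_assoc, mul_assoc, ← pow_succ, h0]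
      rw [← heq, hK, ← Semigroup.mem_center_iff.1 hz] at hmem
      exact hdqz hmem
  exact hpow k (by rw [hk, mul_zero, mul_zero])

theorem IsCentrallyEssential.isNilpotent_of_annihilates {A : Type*} [Ring A] [IsNoetherianRing A]
    (hC : IsCentrallyEssential A) {y : A} (hy : ∀ s ∈ centralNilAnnihilator A, s * y = 0) :
    IsNilpotent y := by
  obtain ⟨n, hn, hstab⟩ := exists_pow_mul_eq_zero_imp y
  refine ⟨n, ?_⟩
  by_contra hne
  obtain ⟨z, hz, hmem, hne'⟩ := hC.exists_mul_mem_centralNilAnnihilator hne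
  apply hne'
  rw [Semigroup.mem_center_iff.1 hz]
  apply hstab
  obtain ⟨m, rfl⟩ := Nat.exists_eq_succ_of_ne_zero hn
  rw [← Semigroup.mem_center_iff.1 hz]
  nth_rw 2 [pow_succ']
  rw [← mul_assoc, hy _ hmem, zero_mul]

theorem HasDistribWitnesses.isNilpotent_or_injective {A : Type*} [Ring A] [IsNoetherianRing A]
    (hW : HasDistribWitnesses A) (hC : IsCentrallyEssential A)
    (hI : ∀ e : A, IsIdempotentElem e → e = 0 ∨ e = 1) (a : A) :
    IsNilpotent a ∨ ∀ s ∈ centralNilAnnihilator A, s * a = 0 → s = 0 := by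
  have hcomm : ∀ s ∈ centralNilAnnihilator A, ∀ g, g * s = s * g := fun s hs =>
    hC.mul_comm_of_mem_centralNilAnnihilator
      (fun c hc => hW.isNilpotent_or_regular_of_mem_center hI hc) hs
  obtain ⟨n, hn, hstab⟩ := exists_pow_mul_eq_zero_imp a
  set e := a ^ n with he
  let X : Ideal A := centralNilAnnihilator A ⊓ LinearMap.ker (LinearMap.toSpanSingleton A A e)
  have hX : ∀ x, x ∈ X ↔ x ∈ centralNilAnnihilator A ∧ x * e = 0 := fun x => by simp [X]
  let Y : Ideal A := Submodule.map (LinearMap.toSpanSingleton A A e) (centralNilAnnihilator A)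
  have hY : ∀ y, y ∈ Y ↔ ∃ s ∈ centralNilAnnihilator A, s * e = y := fun y => by simp [Y]
  obtain ⟨u, huX, huY⟩ := hW.exists_separating X Y
    (fun x hx b => by
      rw [hX] at hx ⊢
      exact ⟨mul_mem_centralNilAnnihilator hx.1 b, by
        rw [← hcomm x hx.1, mul_assoc, hx.2, mul_zero]⟩)
    (fun y hy b => by
      rw [hY] at hy ⊢
      obtain ⟨s, hs, rfl⟩ := hy
      exact ⟨b * s, Ideal.mul_mem_left _ b hs, by
        rw [← hcomm _ (mul_mem_centralNilAnnihilator hs e), mul_assoc]⟩)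
    (Submodule.disjoint_def.2 fun x hx hy => by
      obtain ⟨s, hs, rfl⟩ := (hY _).1 hy
      exact hstab s ((hX _).1 hx).2)
  have hsu : ∀ s ∈ centralNilAnnihilator A, s * (1 - u) * u = 0 := fun s hs => by
    have hs' := mul_mem_centralNilAnnihilator hs (1 - u)
    refine huX _ ((hX _).2 ⟨hs', ?_⟩)
    rw [← hcomm _ hs', ← mul_assoc, hcomm _ hs, mul_sub, mul_one,
      huY _ ((hY _).2 ⟨s, hs, rfl⟩), sub_self]
  have hsuu : ∀ s ∈ centralNilAnnihilator A, s * u * u = s * u := fun s hs => by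
    have := hsu s hs
    rw [mul_sub, mul_one, sub_mul, sub_eq_zero] at this
    exact this.symm
  obtain ⟨k, hk⟩ : IsNilpotent (u - u ^ 2) := hC.isNilpotent_of_annihilates fun s hs => by
    rw [mul_sub, pow_two, ← mul_assoc, hsuu s hs, sub_self]
  have hpow : ∀ s ∈ centralNilAnnihilator A, ∀ j : ℕ, s * u ^ (j + 1) = s * u := by
    intro s hs j
    induction j with
    | zero => simp
    | succ j ih => rw [pow_succ, ← mul_assoc, ih, hsuu s hs]
  have hpow' : ∀ s ∈ centralNilAnnihilator A, ∀ j : ℕ,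
      s * (1 - u ^ (k + 1)) ^ (j + 1) = s * (1 - u) := by
    intro s hs j
    induction j with
    | zero => rw [zero_add, pow_one, mul_sub, hpow s hs, mul_sub]
    | succ j ih =>
      rw [pow_succ, ← mul_assoc, ih, mul_sub (s * (1 - u)), mul_one,
        hpow _ (mul_mem_centralNilAnnihilator hs _), hsu s hs, sub_zero]
  have hidem := isIdempotentElem_one_sub_one_sub_pow_pow u (k + 1)
    (by rw [pow_succ, hk, zero_mul])
  have hsf : ∀ s ∈ centralNilAnnihilator A, s * (1 - (1 - u ^ (k + 1)) ^ (k + 1)) = s * u := by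
    intro s hs
    rw [mul_sub, mul_one, hpow' s hs, mul_sub, mul_one, sub_sub_cancel]
  rcases hI _ hidem with h0 | h1
  · left
    rw [h0] at hsf
    have : IsNilpotent (a ^ n) := hC.isNilpotent_of_annihilates fun s hs => by
      rw [← he, ← huY _ ((hY _).2 ⟨s, hs, rfl⟩),
        ← hsf _ (mul_mem_centralNilAnnihilator hs e), mul_zero]
    exact this.of_pow
  · right
    rw [h1] at hsf
    intro s hs hsa
    have : s ∈ X := (hX _).2 ⟨hs, by
      obtain ⟨m, rfl⟩ := Nat.exists_eq_succ_of_ne_zero hn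
      rw [he, pow_succ', ← mul_assoc, hsa, zero_mul]⟩
    rw [← mul_one s, hsf s hs, huX s this]

theorem HasDistribWitnesses.isNilpotent_or_isUnit {A : Type*} [Ring A] [IsNoetherianRing A]
    (hW : HasDistribWitnesses A) (hC : IsCentrallyEssential A)
    (hI : ∀ e : A, IsIdempotentElem e → e = 0 ∨ e = 1)
    (hn : ∃ z ∈ Set.center A, IsNilpotent z ∧ z ≠ 0) (a : A) : IsNilpotent a ∨ IsUnit a := by
  refine (hW.isNilpotent_or_injective hC hI a).imp_right fun hinj => ?_
  have hD : ∀ c ∈ Set.center A, IsNilpotent c ∨ ∀ x, x * c = 0 → x = 0 :=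
    fun c hc => hW.isNilpotent_or_regular_of_mem_center hI hc
  have hcomm : ∀ s ∈ centralNilAnnihilator A, ∀ g, g * s = s * g := fun s hs =>
    hC.mul_comm_of_mem_centralNilAnnihilator hD hs
  have hsq : ∀ s ∈ centralNilAnnihilator A, s * s = 0 := by
    intro s hs
    have hsc : s ∈ Set.center A := Semigroup.mem_center_iff.2 (hcomm s hs)
    rcases hD s hsc with hnil | hreg
    · exact hs s hsc hnil
    · obtain ⟨z, hz, hznil, hz0⟩ := hn
      exact absurd (hreg z (by rw [hcomm s hs, hs z hz hznil])) hz0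
  have hdiv : ∀ p : centralNilAnnihilator A, ∃ w : centralNilAnnihilator A,
      (w : A) * a = p := by
    rintro ⟨p, hp⟩
    obtain ⟨u, v, r, w, huv, hu, hv⟩ := hW a p
    have hpu : p * u = 0 := by
      have hpu' := mul_mem_centralNilAnnihilator hp u
      refine hinj _ hpu' ?_
      rw [← hcomm _ hpu', ← mul_assoc, hcomm p hp, mul_assoc, hu, ← mul_assoc, hsq p hp, zero_mul]
    have hpaw : p = a * w := by
      rw [← hv, eq_sub_of_add_eq' huv, mul_sub, mul_one, hpu, sub_zero]
    have hw : w ∈ centralNilAnnihilator A := by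
      intro z hz hznil
      by_contra hwz
      obtain ⟨z', -, hmem, hne⟩ := hC.exists_mul_mem_centralNilAnnihilator hwz
      refine hne (hinj _ hmem ?_)
      rw [← hcomm _ hmem, ← mul_assoc, ← mul_assoc, ← hpaw, hp z hz hznil, zero_mul]
    exact ⟨⟨w, hw⟩, by rw [← hcomm w hw, ← hpaw]⟩
  choose f hf using hdiv
  obtain ⟨z, hz, hznil, hz0⟩ := hn
  obtain ⟨z', -, hp, hp0⟩ := hC.exists_mul_mem_centralNilAnnihilator hz0
  let w : ℕ → centralNilAnnihilator A := fun i => f^[i] ⟨z * z', hp⟩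
  have hwsucc : ∀ i, (w (i + 1) : A) * a = w i := fun i => by
    simp only [w, Function.iterate_succ_apply', hf]
  have hw0 : ∀ i, (w i : A) ≠ 0 := by
    intro i
    induction i with
    | zero => exact hp0
    | succ i ih =>
      intro h
      exact ih (by rw [← hwsucc, h, zero_mul])
  let F : ℕ →o Ideal A := ⟨fun i => Ideal.span {(w i : A)}, monotone_nat_of_le_succ fun i => by
    rw [Ideal.span_singleton_le_iff_mem, Ideal.mem_span_singleton']
    exact ⟨a, by rw [hcomm _ (w (i + 1)).2, hwsucc]⟩⟩
  obtain ⟨N, hN⟩ := monotone_stabilizes_iff_noetherian.2 ‹IsNoetherianRing A› F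
  have hmem : (w (N + 1) : A) ∈ Ideal.span {(w N : A)} := by
    have h : Ideal.span {(w N : A)} = Ideal.span {(w (N + 1) : A)} := hN (N + 1) (by omega)
    rw [h]
    exact Ideal.mem_span_singleton_self _
  obtain ⟨r, hr⟩ := Ideal.mem_span_singleton'.1 hmem
  have hkill : (w (N + 1) : A) * (1 - r * a) = 0 := by
    rw [mul_sub, mul_one, ← mul_assoc, ← hcomm _ (w (N + 1)).2 r, mul_assoc, hwsucc, hr, sub_self]
  have hnil : IsNilpotent (1 - r * a) :=
    (hW.isNilpotent_or_injective hC hI (1 - r * a)).resolve_right fun h =>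
      hw0 (N + 1) (h _ (w (N + 1)).2 hkill)
  have hunit : IsUnit (r * a) := by simpa using hnil.isUnit_one_sub
  obtain ⟨l, hl⟩ := hunit.exists_left_inv
  rw [← mul_assoc] at hl
  have hidem : IsIdempotentElem (a * (l * r)) := by
    rw [IsIdempotentElem, ← mul_assoc, mul_assoc a (l * r) a, hl, mul_one]
  rcases hI _ hidem with h0 | h1
  · have h10 : (1 : A) = 0 := calc
      (1 : A) = l * r * a * (l * r * a) := by rw [hl, one_mul]
      _ = l * r * (a * (l * r)) * a := by simp only [mul_assoc]
      _ = 0 := by rw [h0, mul_zero, zero_mul]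
    exact absurd (by rw [← mul_one z, h10, mul_zero]) hz0
  · exact ⟨⟨a, l * r, h1, hl⟩, rfl⟩

theorem Submodule.total_and_isArtinian_of_chain {R M : Type*} [Ring R] [AddCommGroup M] [Module R M]
    (g : ℕ → M) (n : ℕ) (hn : g n = 0) (hg : ∀ i, g (i + 1) ∈ Submodule.span R {g i})
    (h : ∀ m, ∃ i, m ∈ Submodule.span R {g i} ∧ g i ∈ Submodule.span R {m}) :
    (∀ I J : Submodule R M, I ≤ J ∨ J ≤ I) ∧ IsArtinian R M := by
  classical
  have hanti : Antitone fun i => Submodule.span R {g i} :=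
    antitone_nat_of_succ_le fun i => (Submodule.span_singleton_le_iff_mem _ _).2 (hg i)
  have key : ∀ I : Submodule R M, ∃ i : Fin (n + 1), Submodule.span R {g i} = I := by
    intro I
    have hex : ∃ i, g i ∈ I := ⟨n, hn ▸ I.zero_mem⟩
    refine ⟨⟨Nat.find hex, Nat.lt_succ_of_le (Nat.find_min' hex (hn ▸ I.zero_mem))⟩,
      le_antisymm ((Submodule.span_singleton_le_iff_mem _ _).2 (Nat.find_spec hex)) ?_⟩
    intro m hm
    obtain ⟨j, hj, hj'⟩ := h m
    exact hanti (Nat.find_min' hex ((Submodule.span_singleton_le_iff_mem _ _).2 hm hj')) hj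
  refine ⟨fun I J => ?_, ?_⟩
  · obtain ⟨i, rfl⟩ := key I
    obtain ⟨j, rfl⟩ := key J
    exact (le_total (j : ℕ) i).imp (fun hij => hanti hij) (fun hij => hanti hij)
  · have : Finite (Submodule R M) := Finite.of_surjective _ key
    exact (inferInstance : WellFoundedLT (Submodule R M))

theorem HasDistribWitnesses.dvd_total {A : Type*} [Ring A] (hW : HasDistribWitnesses A)
    (hL : ∀ a : A, IsNilpotent a ∨ IsUnit a) (a b : A) : a ∣ b ∨ b ∣ a := by
  obtain ⟨u, v, r, s, huv, hu, hv⟩ := hW a b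
  have huv' : IsUnit u ∨ IsUnit v := by
    rcases hL u with h | h
    · right
      rw [eq_sub_of_add_eq' huv]
      exact h.isUnit_one_sub
    · exact Or.inl h
  rcases huv' with h | h
  · right
    exact (h.dvd_mul_right).1 (hu ▸ dvd_mul_right b r)
  · left
    exact (h.dvd_mul_right).1 (hv ▸ dvd_mul_right a s)

theorem HasDistribWitnesses.dvd_mul_left_of_isNilpotent_or_isUnit {A : Type*} [Ring A]
    (hW : HasDistribWitnesses A) (hL : ∀ a : A, IsNilpotent a ∨ IsUnit a) (a x : A) :
    x ∣ a * x := by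
  rcases hW.dvd_total hL x (a * x) with h | ⟨c, hc⟩
  · exact h
  rcases hL c with ⟨k, hk⟩ | hu
  · have hpow : ∀ k : ℕ, x = a ^ k * x * c ^ k := by
      intro k
      induction k with
      | zero => simp
      | succ k ih =>
        calc x = a ^ k * (a * x * c) * c ^ k := by rw [← hc, ← ih]
          _ = a ^ (k + 1) * x * c ^ (k + 1) := by
            rw [pow_succ, pow_succ']
            simp only [mul_assoc]
    have hx : x = 0 := by rw [hpow k, hk, mul_zero]
    rw [hx, mul_zero]
  · exact (hu.dvd_mul_right).1 (hc ▸ dvd_rfl)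

theorem HasDistribWitnesses.exists_generator {A : Type*} [Ring A] [IsNoetherianRing A]
    (hW : HasDistribWitnesses A) (hL : ∀ a : A, IsNilpotent a ∨ IsUnit a) :
    ∃ x : A, IsNilpotent x ∧ ∀ a, IsNilpotent a → x ∣ a := by
  let K : A → Ideal A := fun x =>
    { carrier := {y | x ∣ y}
      add_mem' := fun h h' => dvd_add h h'
      zero_mem' := dvd_zero x
      smul_mem' := by
        rintro c _ ⟨y, rfl⟩
        rw [smul_eq_mul, Set.mem_ofPred_eq, ← mul_assoc]
        exact (hW.dvd_mul_left_of_isNilpotent_or_isUnit hL c x).mul_right y }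
  have hK : ∀ x y, y ∈ K x ↔ x ∣ y := fun _ _ => Iff.rfl
  obtain ⟨_, ⟨x, hx, rfl⟩, hmax⟩ := set_has_maximal_iff_noetherian.2 ‹IsNoetherianRing A›
    (K '' {x | IsNilpotent x}) ⟨_, 0, IsNilpotent.zero, rfl⟩
  refine ⟨x, hx, fun a ha => ?_⟩
  rcases hW.dvd_total hL x a with h | h
  · exact h
  have hle : K x ≤ K a := fun y hy => h.trans hy
  by_contra hxa
  exact hmax (K a) ⟨a, ha, rfl⟩ (lt_of_le_of_ne hle fun heq =>
    hxa ((hK _ _).1 (heq ▸ (hK a a).2 dvd_rfl)))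

theorem exists_pow_mul_isUnit {A : Type*} [Monoid A] {x : A} (h : ∀ a : A, x ∣ a ∨ IsUnit a)
    (n : ℕ) (a : A) : x ^ n ∣ a ∨ ∃ i < n, ∃ u, IsUnit u ∧ a = x ^ i * u := by
  induction n with
  | zero => simp
  | succ n ih =>
    rcases ih with ⟨b, rfl⟩ | ⟨i, hi, u, hu, rfl⟩
    · rcases h b with ⟨c, rfl⟩ | hb
      · left
        rw [← mul_assoc, ← pow_succ]
        exact dvd_mul_right _ _
      · exact Or.inr ⟨n, n.lt_succ_self, b, hb, rfl⟩
    · exact Or.inr ⟨i, hi.trans n.lt_succ_self, u, hu, rfl⟩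

theorem exists_isUnit_mul_pow {A : Type*} [Monoid A] {x : A}
    (h : ∀ a : A, (∃ c, a = c * x) ∨ IsUnit a) (n : ℕ) (a : A) :
    (∃ c, a = c * x ^ n) ∨ ∃ i < n, ∃ u, IsUnit u ∧ a = u * x ^ i := by
  induction n with
  | zero => simp
  | succ n ih =>
    rcases ih with ⟨b, rfl⟩ | ⟨i, hi, u, hu, rfl⟩
    · rcases h b with ⟨c, rfl⟩ | hb
      · exact Or.inl ⟨c, by rw [mul_assoc, ← pow_succ']⟩
      · exact Or.inr ⟨n, n.lt_succ_self, b, hb, rfl⟩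
    · exact Or.inr ⟨i, hi.trans n.lt_succ_self, u, hu, rfl⟩

/-- In a local ring with nilpotent maximal ideal `xA ⊇ Ax` whose last nonzero power of `x` is
central, one has `xA ⊆ Ax`. -/
theorem exists_mul_eq_of_pow_central {A : Type*} [Ring A] {x : A} {m : ℕ}
    (hx : x ^ (m + 2) = 0) (hx0 : x ^ (m + 1) ≠ 0) (hcomm : ∀ a, a * x ^ (m + 1) = x ^ (m + 1) * a)
    (hr : ∀ a, x ∣ a * x) (hL : ∀ a, x ∣ a ∨ IsUnit a) (a : A) : ∃ b, x * a = b * x := by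
  choose σ hσ using hr
  have hσpow : ∀ (k : ℕ) (a : A), a * x ^ k = x ^ k * σ^[k] a := by
    intro k
    induction k with
    | zero => simp
    | succ k ih =>
      intro a
      rw [pow_succ, ← mul_assoc, ih, mul_assoc, hσ, Function.iterate_succ_apply', mul_assoc]
  have step : ∀ a, ∃ b c, x * a = b * x + x * x * c := by
    intro a
    have hzero : x ^ (m + 1) * (σ^[m + 1] a - a) = 0 := by
      rw [mul_sub, ← hσpow, hcomm, sub_self]
    rcases hL (σ^[m + 1] a - a) with ⟨c, hc⟩ | hu
    · refine ⟨σ^[m] a, -c, ?_⟩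
      rw [hσ, ← Function.iterate_succ_apply' σ, mul_neg, mul_assoc, ← hc, mul_sub]
      abel
    · exact absurd (hu.mul_left_eq_zero.1 hzero) hx0
  have hpow : ∀ (k : ℕ) (a : A), ∃ b c, x * a = b * x + x ^ (k + 1) * c := by
    intro k a
    induction k with
    | zero => exact ⟨0, a, by simp⟩
    | succ k ih =>
      obtain ⟨b, c, hbc⟩ := ih
      obtain ⟨b', c', hbc'⟩ := step c
      refine ⟨b + x ^ k * b', c', ?_⟩
      rw [hbc, pow_succ, mul_assoc, hbc', pow_succ, pow_succ]
      simp only [mul_add, add_mul, mul_assoc, add_assoc]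
  obtain ⟨b, c, h⟩ := hpow (m + 1) a
  exact ⟨b, by rw [h, hx, zero_mul, add_zero]⟩

theorem HasDistribWitnesses.isUniserialRing_and_isArtinianBothSides {A : Type*} [Ring A]
    [Nontrivial A] [IsNoetherianRing A] (hW : HasDistribWitnesses A) (hC : IsCentrallyEssential A)
    (hI : ∀ e : A, IsIdempotentElem e → e = 0 ∨ e = 1)
    (hn : ∃ z ∈ Set.center A, IsNilpotent z ∧ z ≠ 0) :
    IsUniserialRing A ∧ IsArtinianBothSides A := by
  have hL := hW.isNilpotent_or_isUnit hC hI hn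
  obtain ⟨x, hx, hgen⟩ := hW.exists_generator hL
  have hdvd : ∀ a, x ∣ a ∨ IsUnit a := fun a => (hL a).imp_left (hgen a)
  have hr := fun a => hW.dvd_mul_left_of_isNilpotent_or_isUnit hL a x
  have hleft : ∀ a, ∃ b, x * a = b * x := by
    obtain ⟨k, hk⟩ : ∃ k, nilpotencyClass x = k := ⟨_, rfl⟩
    have hxk : x ^ k = 0 := hk ▸ pow_nilpotencyClass hx
    match k, hk, hxk with
    | 0, _, hxk => exact absurd hxk (by simp)
    | 1, _, hxk => exact fun a => ⟨0, by rw [pow_one] at hxk; simp [hxk]⟩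
    | m + 2, hk, hxk =>
      have hx0 : x ^ (m + 1) ≠ 0 := by
        have := pow_pred_nilpotencyClass hx
        rwa [hk] at this
      obtain ⟨z, -, hp, hp0⟩ := hC.exists_mul_mem_centralNilAnnihilator (one_ne_zero (α := A))
      have hmem : x ^ (m + 1) ∈ centralNilAnnihilator A := by
        rcases exists_pow_mul_isUnit hdvd (m + 2) (1 * z) with ⟨c, hc⟩ | ⟨i, hi, u, hu, hpu⟩
        · exact absurd (by rw [hc, hxk, zero_mul]) hp0
        · obtain ⟨v, hv⟩ := hu.exists_right_inv
          have := mul_mem_centralNilAnnihilator hp (v * x ^ (m + 1 - i))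
          rwa [hpu, mul_assoc, ← mul_assoc u, hv, one_mul, ← pow_add,
            Nat.add_sub_cancel' (by omega)] at this
      exact exists_mul_eq_of_pow_central hxk hx0 (hC.mul_comm_of_mem_centralNilAnnihilator
        (fun c hc => hW.isNilpotent_or_regular_of_mem_center hI hc) hmem) hr hdvd
  have hdvd' : ∀ a, (∃ c, a = c * x) ∨ IsUnit a := fun a => (hdvd a).imp_left <| by
    rintro ⟨c, rfl⟩
    exact hleft c
  obtain ⟨n, hxn⟩ := hx
  have hR := Submodule.total_and_isArtinian_of_chain (R := Aᵐᵒᵖ) (fun i => x ^ i) n hxn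
    (fun i => mem_rightSpan_singleton.2 ⟨x, pow_succ x i⟩) fun a => by
      rcases exists_pow_mul_isUnit hdvd n a with ⟨c, rfl⟩ | ⟨i, -, u, hu, rfl⟩
      · exact ⟨n, by simp [hxn], by simp [hxn]⟩
      · obtain ⟨v, hv⟩ := hu.exists_right_inv
        exact ⟨i, mem_rightSpan_singleton.2 ⟨u, rfl⟩,
          mem_rightSpan_singleton.2 ⟨v, by rw [mul_assoc, hv, mul_one]⟩⟩
  have hLeft := Submodule.total_and_isArtinian_of_chain (R := A) (fun i => x ^ i) n hxn
    (fun i => Submodule.mem_span_singleton.2 ⟨x, (pow_succ' x i).symm⟩) fun a => by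
      rcases exists_isUnit_mul_pow hdvd' n a with ⟨c, rfl⟩ | ⟨i, -, u, hu, rfl⟩
      · exact ⟨n, by simp [hxn], by simp [hxn]⟩
      · obtain ⟨v, hv⟩ := hu.exists_left_inv
        exact ⟨i, Submodule.mem_span_singleton.2 ⟨u, rfl⟩,
          Submodule.mem_span_singleton.2 ⟨v, by rw [smul_eq_mul, ← mul_assoc, hv, one_mul]⟩⟩
  exact ⟨⟨hR.1, hLeft.1⟩, hLeft.2, hR.2⟩

theorem isDedekindDomain_of_hasDistribWitnesses_of_mul_eq_zero {R : Type*} [CommRing R]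
    [Nontrivial R] [IsNoetherianRing R] (h : HasDistribWitnesses R)
    (h0 : ∀ x y : R, y ≠ 0 → x * y = 0 → x = 0) : IsDedekindDomain R := by
  have : NoZeroDivisors R := ⟨fun {x y} hxy => or_iff_not_imp_right.2 fun hy => h0 x y hy hxy⟩
  have : IsDomain R := NoZeroDivisors.to_isDomain R
  exact isDedekindDomain_of_hasDistribWitnesses h

theorem HasDistribWitnesses.isGoodFactor {A : Type*} [Ring A] [Nontrivial A] [IsNoetherianRing A]
    (hW : HasDistribWitnesses A) (hC : IsCentrallyEssential A)
    (hI : ∀ e : A, IsIdempotentElem e → e = 0 ∨ e = 1) : IsGoodFactor A := by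
  by_cases hn : ∃ z ∈ Set.center A, IsNilpotent z ∧ z ≠ 0
  · obtain ⟨h1, h2⟩ := hW.isUniserialRing_and_isArtinianBothSides hC hI hn
    exact Or.inl ⟨h1, h2, hC⟩
  · right
    push Not at hn
    have hreg : ∀ c ∈ Set.center A, c ≠ 0 → ∀ x, x * c = 0 → x = 0 := fun c hc hc0 =>
      (hW.isNilpotent_or_regular_of_mem_center hI hc).resolve_left fun h => hc0 (hn c hc h)
    have hcomm : ∀ x y : A, x * y = y * x := by
      intro x y
      rcases eq_or_ne x 0 with rfl | hx
      · simp
      obtain ⟨c, d, hc, hd, hc0, -, hcd⟩ := hC x hx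
      refine sub_eq_zero.1 (hreg c hc hc0 _ ?_)
      rw [sub_mul, mul_assoc, Semigroup.mem_center_iff.1 hc y, ← mul_assoc, hcd, mul_assoc, hcd,
        Semigroup.mem_center_iff.1 hd y, sub_self]
    refine ⟨hcomm, ?_⟩
    exact @isDedekindDomain_of_hasDistribWitnesses_of_mul_eq_zero A (Ring.commRingOfComm A hcomm)
      ‹_› ‹_› hW fun x y hy => hreg y (Semigroup.mem_center_iff.2 fun g => hcomm g y) hy x

theorem IsCentrallyEssential.of_pi {ι : Type*} {B : ι → Type*} [∀ i, Ring (B i)]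
    (h : IsCentrallyEssential (∀ i, B i)) (i : ι) : IsCentrallyEssential (B i) := by
  classical
  intro a ha
  obtain ⟨c, d, hc, hd, -, hd0, hcd⟩ := h (Pi.single i a) (by simpa)
  have hcen : ∀ x ∈ Set.center (∀ i, B i), x i ∈ Set.center (B i) := fun x hx =>
    Semigroup.mem_center_iff.2 fun g => by
      simpa using congrFun (Semigroup.mem_center_iff.1 hx (Pi.single i g)) i
  have hdi : a * c i = d i := by simpa using congrFun hcd i
  have hd0 : d i ≠ 0 := fun h0 => hd0 <| funext fun j => by
    rcases eq_or_ne j i with rfl | hj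
    · exact h0
    · simp [← hcd, hj]
  refine ⟨c i, d i, hcen c hc, hcen d hd, fun h0 => hd0 ?_, hd0, hdi⟩
  rw [← hdi, h0, mul_zero]

theorem span_one_sub_lt_span_one_sub {A : Type*} [Ring A] {e f : A} (he : IsIdempotentElem e)
    (hfe : f * e = f) (hef : e * f = f) (hne : f ≠ e) :
    Ideal.span {1 - e} < Ideal.span {1 - f} := by
  refine lt_of_le_of_ne ?_ fun heq => hne ?_
  · rw [Ideal.span_singleton_le_iff_mem, Ideal.mem_span_singleton']
    exact ⟨1 - e, by rw [mul_sub, mul_one, sub_mul, one_mul, hef, sub_self, sub_zero]⟩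
  · have hf : 1 - f ∈ Ideal.span {1 - e} := heq ▸ Ideal.mem_span_singleton_self (1 - f)
    obtain ⟨a, ha⟩ := Ideal.mem_span_singleton'.1 hf
    have h0 : (1 - f) * e = 0 := by rw [← ha, mul_assoc, he.one_sub_mul_self, mul_zero]
    rw [sub_mul, one_mul, hfe, sub_eq_zero] at h0
    exact h0.symm

/-- In a left Noetherian ring with central idempotents, each idempotent is a finite sum of
orthogonal primitive idempotents. -/
theorem exists_finset_primitive_idempotents {A : Type*} [Ring A] [IsNoetherianRing A]
    (hcen : ∀ e : A, IsIdempotentElem e → ∀ x, x * e = e * x) (e : A) (he : IsIdempotentElem e) :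
    ∃ s : Finset A,
      (∀ g ∈ s, IsIdempotentElem g ∧ g ≠ 0 ∧
        ∀ f, IsIdempotentElem f → f * g = f → f = 0 ∨ f = g) ∧
      (∀ g ∈ s, ∀ h ∈ s, g ≠ h → g * h = 0) ∧ ∑ g ∈ s, g = e := by
  classical
  induction hI : Ideal.span {1 - e} using WellFoundedGT.induction generalizing e with
  | ind I ih =>
    subst hI
    by_cases he0 : e = 0
    · exact ⟨∅, by simp, by simp, by simp [he0]⟩
    by_cases hprim : ∀ f, IsIdempotentElem f → f * e = f → f = 0 ∨ f = e
    · exact ⟨{e}, by simpa using ⟨he, he0, hprim⟩, by simp, by simp⟩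
    push Not at hprim
    obtain ⟨f, hf, hfe, hf0, hne⟩ := hprim
    have hef : e * f = f := by rw [← hcen e he, hfe]
    have hee : e * e = e := he
    have hff : f * f = f := hf
    have hg : IsIdempotentElem (e - f) := by
      change (e - f) * (e - f) = e - f
      rw [mul_sub, sub_mul, sub_mul, hee, hfe, hef, hff, sub_self, sub_zero]
    have hfg : f * (e - f) = 0 := by rw [mul_sub, hfe, hff, sub_self]
    obtain ⟨s, hs, hso, hss⟩ := ih _ (span_one_sub_lt_span_one_sub he hfe hef hne) f hf rfl
    obtain ⟨t, ht, hto, hts⟩ := ih _ (span_one_sub_lt_span_one_sub he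
      (by rw [sub_mul, hee, hfe]) (by rw [mul_sub, hee, hef]) (by simpa using hf0)) (e - f) hg rfl
    have hmul : ∀ (s : Finset A), (∀ g ∈ s, IsIdempotentElem g) →
        (∀ g ∈ s, ∀ h ∈ s, g ≠ h → g * h = 0) → ∀ g ∈ s, g * ∑ h ∈ s, h = g := by
      intro s hs hso g hg
      rw [Finset.mul_sum, Finset.sum_eq_single g (fun h hh hne => hso g hg h hh hne.symm)
        (fun h => absurd hg h)]
      exact hs g hg
    have hst : ∀ g ∈ s, ∀ h ∈ t, g * h = 0 := by
      intro g hgs h hht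
      have h1 := hmul s (fun g hg => (hs g hg).1) hso g hgs
      have h2 := hmul t (fun g hg => (ht g hg).1) hto h hht
      rw [hss] at h1
      rw [hts, hcen _ hg] at h2
      rw [← h1, ← h2, mul_assoc, ← mul_assoc f, hfg, zero_mul, mul_zero]
    have hdisj : Disjoint s t := Finset.disjoint_left.2 fun g hgs hgt =>
      (hs g hgs).2.1 ((hs g hgs).1.eq.symm.trans (hst g hgs g hgt))
    refine ⟨s ∪ t, fun g hg => (Finset.mem_union.1 hg).elim (hs g) (ht g), ?_, ?_⟩
    · intro g hg h hh hgh
      rcases Finset.mem_union.1 hg with hg | hg <;> rcases Finset.mem_union.1 hh with hh | hh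
      · exact hso g hg h hh hgh
      · exact hst g hg h hh
      · rw [hcen h (hs h hh).1, hst h hh g hg]
      · exact hto g hg h hh hgh
    · rw [Finset.sum_union hdisj, hss, hts, add_sub_cancel]

/-- A ring `A` is a right distributive, left Noetherian, centrally essential ring if and
only if `A` is isomorphic to a finite direct product `A₁ × ⋯ × Aₙ` of rings, where each
`Aᵢ` is either a uniserial Artinian centrally essential ring or a commutative Dedekind
domain. -/
theorem rightDistributive_leftNoetherian_centrallyEssential_iff {A : Type u} [Ring A]
    [Nontrivial A] :
    (IsRightDistributive A ∧ IsNoetherian A A ∧ IsCentrallyEssential A) ↔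
    ∃ (n : ℕ) (B : Fin n → Type u) (instB : ∀ i, Ring (B i)),
      letI := instB
      Nonempty (A ≃+* ∀ i, B i) ∧ ∀ i, IsGoodFactor (B i) := by
  constructor
  · rintro ⟨hD, hN, hC⟩
    have hW := isRightDistributive_iff.1 hD
    have hcen : ∀ e : A, IsIdempotentElem e → ∀ x, x * e = e * x := fun e he =>
      Semigroup.mem_center_iff.1 (hC.idempotent_mem_center he)
    obtain ⟨s, hs, hso, hss⟩ := exists_finset_primitive_idempotents hcen 1 IsIdempotentElem.one
    let e : Fin s.card → A := fun i => s.equivFin.symm i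
    have hmem : ∀ i, e i ∈ s := fun i => (s.equivFin.symm i).2
    have he : CompleteOrthogonalIdempotents e :=
      { idem := fun i => (hs _ (hmem i)).1
        ortho := fun i j hij => hso _ (hmem i) _ (hmem j) fun h =>
          hij (s.equivFin.symm.injective (Subtype.ext h))
        complete := by
          rw [← hss, ← Finset.sum_coe_sort s]
          exact s.equivFin.symm.sum_comp fun g : s => (g : A) }
    let φ := he.ringEquivOfIsMulCentral fun i => hC.idempotent_mem_center (he.idem i)
    refine ⟨s.card, fun i => (he.idem i).Corner, inferInstance, ⟨φ⟩, fun i => ?_⟩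
    let π : A →+* (he.idem i).Corner := (Pi.evalRingHom _ i).comp φ.toRingHom
    have hπ : Function.Surjective π := (Function.surjective_eval i).comp φ.surjective
    obtain ⟨-, hne, hprim⟩ := hs _ (hmem i)
    have : Nontrivial (he.idem i).Corner := ⟨1, 0, fun h => hne (congrArg Subtype.val h)⟩
    have : IsNoetherianRing (he.idem i).Corner := isNoetherianRing_of_surjective _ _ π hπ
    refine (hW.of_surjective π hπ).isGoodFactor ((hC.of_ringEquiv φ).of_pi i) fun f hf => ?_
    exact (hprim f.1 (congrArg Subtype.val hf)
      ((Subsemigroup.mem_corner_iff (he.idem i)).1 f.2).2).imp Subtype.ext Subtype.ext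
  · rintro ⟨n, B, instB, ⟨φ⟩, hB⟩
    have hprop := fun i => (hB i).properties
    have hN : ∀ i, IsNoetherianRing (B i) := fun i => (hprop i).2.1
    exact ⟨isRightDistributive_iff.2 ((HasDistribWitnesses.pi fun i => (hprop i).1).of_surjective
      φ.symm.toRingHom φ.symm.surjective), isNoetherianRing_of_ringEquiv _ φ.symm,
      (IsCentrallyEssential.pi fun i => (hprop i).2.2).of_ringEquiv φ.symm⟩
end
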